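/- arXiv:0901.1652 — 2 statements merged into one kernel-verified Lean document; each statement's English description precedes it below -/
import Mathlib

section
/- Short-scale fluctuation bound: there exists a constant β₀ such that for every β ≥ β₀, every ε > 0, every L ≥ 8β^{1/4}, every pair of sites x, y ∈ Λ with periodic distance |x − y| ≤ β^{1/4}, and every real m ≥ 0 with 3m ≤ β^{1/8}, one has ⟨B_{xy}^{3m}⟩ₜₛ ≤ 2. -/
open scoped BigOperators Classical
open MeasureTheory

noncomputable section

/-- The 3-dimensional discrete torus of side `L`. -/
abbrev Torus (L : ℕ) := Fin 3 → ZMod L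

/-- The unit vector in direction `i`. -/
def unitVec (L : ℕ) (i : Fin 3) : Torus L := fun j => if j = i then 1 else 0

/-- Nearest-neighbor relation on the torus. -/
def NN {L : ℕ} (x y : Torus L) : Prop :=
  x ≠ y ∧ ∃ i : Fin 3, y = x + unitVec L i ∨ y = x - unitVec L i

/-- Periodic (Euclidean) distance on the torus. -/
def torusDist {L : ℕ} (x y : Torus L) : ℝ :=
  Real.sqrt (∑ i : Fin 3, (min ((x i - y i).val) (L - (x i - y i).val) : ℝ) ^ 2)

variable {L : ℕ}

/-- Sum of a (symmetric) function over unordered nearest-neighbor pairs. -/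
def nnSum [NeZero L] (f : Torus L → Torus L → ℝ) : ℝ :=
  (1 / 2) * ∑ x : Torus L, ∑ y : Torus L, if NN x y then f x y else 0

/-- The matrix of the operator `D_{β,ε}(t)`, the symmetric operator on `ℝ^Λ` with
quadratic form `β ∑_{NN (ij)} e^{t_i+t_j}(v_i-v_j)² + ε ∑_k e^{t_k} v_k²`. -/
def Dmat [NeZero L] (β ε : ℝ) (t : Torus L → ℝ) : Matrix (Torus L) (Torus L) ℝ :=
  Matrix.of fun j k =>
    if j = k then
      β * (∑ i : Torus L, if NN i j then Real.exp (t i + t j) else 0) + ε * Real.exp (t j)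
    else if NN j k then -(β * Real.exp (t j + t k)) else 0

/-- The free energy (effective action) `F_{β,ε}(t)`. -/
def freeEnergy [NeZero L] (β ε : ℝ) (t : Torus L → ℝ) : ℝ :=
  β * nnSum (fun i j => Real.cosh (t i - t j) - 1)
    - (1 / 2) * Real.log (Dmat β ε t).det
    + ∑ k : Torus L, (t k - ε + ε * Real.cosh (t k))

/-- The expectation `⟨f⟩ = ∫ f(t) e^{-F_{β,ε}(t)} ∏ dt_k/√(2π)`. -/
def expect [NeZero L] (β ε : ℝ) (f : (Torus L → ℝ) → ℝ) : ℝ :=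
  ∫ t : Torus L → ℝ,
    f t * Real.exp (-(freeEnergy β ε t)) *
      ((Real.sqrt (2 * Real.pi))⁻¹) ^ (Fintype.card (Torus L))

/-- `B_{xy} = cosh(t_x - t_y) + (1/2)(s_x - s_y)² e^{t_x+t_y}`. -/
def Bq {L : ℕ} (t s : Torus L → ℝ) (x y : Torus L) : ℝ :=
  Real.cosh (t x - t y) + (1 / 2) * (s x - s y) ^ 2 * Real.exp (t x + t y)

/-- `z^b_k = cosh t_k + (1/2) s_k² e^{t_k}`. -/
def zb {L : ℕ} (t s : Torus L → ℝ) (k : Torus L) : ℝ :=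
  Real.cosh (t k) + (1 / 2) * (s k) ^ 2 * Real.exp (t k)

/-- The `(t,s)`-expectation of the `H^{2|2}` model after integrating out the
Grassmann fields. -/
def tsExpect [NeZero L] (β ε : ℝ) (g : (Torus L → ℝ) → (Torus L → ℝ) → ℝ) : ℝ :=
  ∫ p : (Torus L → ℝ) × (Torus L → ℝ),
    g p.1 p.2 * (Dmat β ε p.1).det *
      Real.exp (-(β * nnSum (fun i j => Bq p.1 p.2 i j - 1))
        - ε * ∑ k : Torus L, (zb p.1 p.2 k - 1)) *
      (∏ k : Torus L, Real.exp (-(p.1 k))) * ((2 * Real.pi)⁻¹) ^ (Fintype.card (Torus L))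

/-- The coordinate unit vector `δ_x`. -/
def delta {L : ℕ} (x : Torus L) : Torus L → ℝ := fun j => if j = x then 1 else 0

/-- `[u ; G v] = ∑_{a,b} u_a G_{ab} v_b`. -/
def qform [NeZero L] (G : Matrix (Torus L) (Torus L) ℝ) (u v : Torus L → ℝ) : ℝ :=
  ∑ a : Torus L, ∑ b : Torus L, u a * G a b * v b

def FF (a v : ℝ) : ℝ := Real.exp (-v^2/2) * (1 + v / √(v^2+4*a))
lemma FF_nonneg (a v : ℝ) (ha : 0 ≤ a) : 0 ≤ FF a v := by
  unfold FF
  apply mul_nonneg (Real.exp_pos _).le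
  have h : |v| ≤ √(v^2+4*a) := Real.abs_le_sqrt (by linarith)
  have h2 : |v / √(v^2+4*a)| ≤ 1 := by
    rw [abs_div, abs_of_nonneg (Real.sqrt_nonneg _)]
    exact div_le_one_of_le₀ h (Real.sqrt_nonneg _)
  linarith [neg_abs_le (v / √(v^2+4*a))]
lemma FF_meas (a : ℝ) : Measurable (FF a) := by unfold FF; fun_prop
lemma gauss_lint : ∫⁻ v : ℝ, ENNReal.ofReal (Real.exp (-v^2/2)) = ENNReal.ofReal (√(2*Real.pi)) := by
  have h := integral_gaussian (1/2)
  rw [← ofReal_integral_eq_lintegral_ofReal]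
  · congr 1
    rw [show 2 * Real.pi = Real.pi / (1/2) by ring, ← h]
    congr 1; ext v; congr 1; ring
  · have := integrable_exp_neg_mul_sq (b := 1/2) (by norm_num)
    convert this using 3; ring
  · exact Filter.Eventually.of_forall fun v => (Real.exp_pos _).le
lemma FF_lint (a : ℝ) (ha : 0 ≤ a) : ∫⁻ v : ℝ, ENNReal.ofReal (FF a v) = ENNReal.ofReal (√(2*Real.pi)) := by
  have h1 : ∫⁻ v : ℝ, ENNReal.ofReal (FF a (-v)) = ∫⁻ v : ℝ, ENNReal.ofReal (FF a v) :=
    lintegral_neg_eq_self (fun v => ENNReal.ofReal (FF a v))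
  have h2 : (∫⁻ v : ℝ, ENNReal.ofReal (FF a v)) + ∫⁻ v : ℝ, ENNReal.ofReal (FF a (-v))
      = 2 * ENNReal.ofReal (√(2*Real.pi)) := by
    rw [← lintegral_add_left ((FF_meas a).ennreal_ofReal), ← gauss_lint, ← lintegral_const_mul _ (by fun_prop)]
    congr 1; ext v
    rw [← ENNReal.ofReal_add (FF_nonneg a v ha) (FF_nonneg a _ ha)]
    rw [show (2:ENNReal) = ENNReal.ofReal 2 by simp, ← ENNReal.ofReal_mul (by norm_num)]
    congr 1; unfold FF; rw [neg_sq]; ring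
  rw [h1, ← two_mul] at h2
  exact (ENNReal.mul_right_inj (by norm_num) (by norm_num)).1 h2

lemma lemA (c : ℝ) : ∫⁻ x in Set.Ioi (0:ℝ), ENNReal.ofReal (Real.exp (-(1/2)*(x + c^2/x)) / √x)
    ≤ ENNReal.ofReal (√(2*Real.pi) * Real.exp (-c)) := by
  set a := |c| with haa
  have ha : 0 ≤ a := abs_nonneg c
  have hca : c^2 = a^2 := (sq_abs c).symm
  let h : ℝ → ℝ := fun x => √x - a / √x
  let h' : ℝ → ℝ := fun x => 1/(2*√x) - (0 * √x - a * (1/(2*√x))) / (√x)^2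
  have hd : ∀ x ∈ Set.Ioi (0:ℝ), HasDerivWithinAt h (h' x) (Set.Ioi 0) x := by
    intro x hx
    have hx : 0 < x := hx
    have hs := Real.hasDerivAt_sqrt hx.ne'
    exact (hs.sub ((hasDerivAt_const x a).div hs (Real.sqrt_pos.2 hx).ne')).hasDerivWithinAt
  have hinj : Set.InjOn h (Set.Ioi 0) := by
    apply StrictMonoOn.injOn
    intro x hx y hy hxy
    have h1 : √x < √y := Real.sqrt_lt_sqrt (le_of_lt hx) hxy
    have h2 : a / √y ≤ a / √x := div_le_div_of_nonneg_left ha (Real.sqrt_pos.2 hx) h1.le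
    simp only [h]; linarith
  have key := lintegral_image_eq_lintegral_abs_deriv_mul measurableSet_Ioi hd hinj
    (fun v => ENNReal.ofReal (FF a v))
  have e1 : ∫⁻ x in Set.Ioi (0:ℝ), ENNReal.ofReal (Real.exp (-(1/2)*(x + c^2/x)) / √x)
      = ∫⁻ x in Set.Ioi (0:ℝ), ENNReal.ofReal (Real.exp (-a)) * (ENNReal.ofReal |h' x| * ENNReal.ofReal (FF a (h x))) := by
    apply setLIntegral_congr_fun measurableSet_Ioi
    intro x hx
    have hx : 0 < x := hx
    obtain ⟨u, hu, rfl⟩ : ∃ u, 0 < u ∧ x = u^2 := ⟨√x, Real.sqrt_pos.2 hx, (Real.sq_sqrt hx.le).symm⟩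
    have hsu : √(u^2) = u := Real.sqrt_sq hu.le
    have hh' : h' (u^2) = (u + a/u)/(2*u^2) := by
      simp only [h', hsu]; field_simp; ring
    have hh : h (u^2) = u - a/u := by simp only [h, hsu]
    have hpos : 0 ≤ h' (u^2) := by rw [hh']; positivity
    have hsq : √((u - a/u)^2 + 4*a) = u + a/u := by
      rw [show (u - a/u)^2 + 4*a = (u+a/u)^2 by field_simp; ring]
      exact Real.sqrt_sq (by positivity)
    dsimp only
    rw [← ENNReal.ofReal_mul (abs_nonneg _), ← ENNReal.ofReal_mul (Real.exp_pos _).le, abs_of_nonneg hpos, hh', hh, hsu]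
    congr 1
    unfold FF
    rw [hsq, hca, show -(1/2) * (u^2 + a^2/u^2) = -a + -(u - a/u)^2/2 by field_simp; ring, Real.exp_add]
    have : u + a/u ≠ 0 := by positivity
    have h3 : u^2 + a ≠ 0 := by positivity
    field_simp
    ring
  rw [e1, lintegral_const_mul' _ _ ENNReal.ofReal_ne_top, ← key, mul_comm (√_), ENNReal.ofReal_mul (Real.exp_pos _).le, ← FF_lint a ha]
  gcongr
  · exact le_abs_self c
  · exact Measure.restrict_le_self

open Matrix in
lemma schur {α : Type} [Fintype α] [DecidableEq α] (H' : Matrix α α ℝ) (hH' : H'.PosDef)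
    (w η' : α → ℝ) (h00 η0 : ℝ)
    (hH : (fromBlocks (of fun _ _ : Unit => h00) (of fun (_ : Unit) j => -w j)
      (of fun i (_ : Unit) => -w i) H').PosDef) :
    let H := fromBlocks (of fun _ _ : Unit => h00) (of fun (_ : Unit) j => -w j)
      (of fun i (_ : Unit) => -w i) H'
    let x := h00 - w ⬝ᵥ H'⁻¹ *ᵥ w
    let c := η0 + w ⬝ᵥ H'⁻¹ *ᵥ η'
    let η : Unit ⊕ α → ℝ := Sum.elim (fun _ => η0) η'
    H.det = H'.det * x ∧ 0 < x ∧ η ⬝ᵥ H⁻¹ *ᵥ η = η' ⬝ᵥ H'⁻¹ *ᵥ η' + c^2/x ∧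
      1 ⬝ᵥ H *ᵥ 1 = h00 - 2 * (w ⬝ᵥ 1) + 1 ⬝ᵥ H' *ᵥ 1 := by
  intro H x c η
  have hdet : H.det = H'.det * x := by
    let _ := hH'.isUnit.invertible
    simp only [H]
    rw [det_fromBlocks₂₂]
    congr 1
    rw [det_unique]
    simp only [x, Matrix.sub_apply, of_apply, invOf_eq_nonsing_inv]
    congr 1
    rw [Matrix.mul_assoc, mul_apply]
    simp only [of_apply, dotProduct, mulVec, mul_apply]
    simp
  have hx : 0 < x := by
    have h1 := hH.det_pos
    have h2 := hH'.det_pos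
    change 0 < H.det at h1
    rw [hdet] at h1
    exact (pos_iff_pos_of_mul_pos h1).1 h2
  refine ⟨hdet, hx, ?_, ?_⟩
  · have hsym : ∀ a b : α → ℝ, a ⬝ᵥ H'⁻¹ *ᵥ b = b ⬝ᵥ H'⁻¹ *ᵥ a := by
      intro a b
      have hs : (H'⁻¹)ᵀ = H'⁻¹ := by
        have := hH'.inv.1
        rwa [IsHermitian, conjTranspose_eq_transpose_of_trivial] at this
      rw [dotProduct_mulVec, dotProduct_comm, ← mulVec_transpose, hs]
    have hHH : H' * H'⁻¹ = 1 := Matrix.mul_nonsing_inv _ (hH'.isUnit.map detMonoidHom)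
    have hHi : H⁻¹ * H = 1 := Matrix.nonsing_inv_mul _ (hH.isUnit.map detMonoidHom)
    let v : Unit ⊕ α → ℝ := Sum.elim (fun _ => c / x) (H'⁻¹ *ᵥ (η' + (c/x) • w))
    have hv : H *ᵥ v = η := by
      simp only [H, v, fromBlocks_mulVec]
      ext i
      rcases i with i | i
      · have h1 : ((of fun (_ : Unit) j => -w j) *ᵥ (H'⁻¹ *ᵥ (η' + (c/x) • w))) i
            = - (w ⬝ᵥ (H'⁻¹ *ᵥ (η' + (c/x) • w))) := by
          simp [mulVec, dotProduct, Finset.sum_neg_distrib]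
        have h2 : ((of fun _ _ : Unit => h00) *ᵥ fun _ => c / x) i = h00 * (c/x) := by
          simp [mulVec, dotProduct]
        simp only [Sum.elim_inl, Pi.add_apply, Function.comp_def, Sum.elim_inr, h1, h2, η]
        rw [mulVec_add, dotProduct_add, mulVec_smul, dotProduct_smul, smul_eq_mul]
        have : c / x * x = c := by field_simp
        simp only [x, c] at this ⊢
        linear_combination this
      · have h2 : ((of fun i (_ : Unit) => -w i) *ᵥ fun _ => c / x) i = - w i * (c/x) := by
          simp [mulVec, dotProduct]
        simp only [Sum.elim_inl, Pi.add_apply, Function.comp_def, Sum.elim_inr, h2, η]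
        rw [mulVec_mulVec, hHH, one_mulVec]
        simp; ring
    have hv2 : H⁻¹ *ᵥ η = v := by rw [← hv, mulVec_mulVec, hHi, one_mulVec]
    rw [hv2]
    simp only [η, v, sumElim_dotProduct_sumElim]
    rw [mulVec_add, dotProduct_add, mulVec_smul, dotProduct_smul, smul_eq_mul, hsym η' w]
    simp only [dotProduct, Finset.univ_unique, Finset.sum_singleton]
    simp only [c, dotProduct]
    ring
  · have h1 : (1 : Unit ⊕ α → ℝ) = Sum.elim (fun _ => 1) 1 := by ext i; rcases i <;> rfl
    rw [h1]
    simp only [H, fromBlocks_mulVec, sumElim_dotProduct_sumElim, Function.comp_def, Sum.elim_inl, Sum.elim_inr, dotProduct_add]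
    simp [mulVec, dotProduct, Finset.sum_neg_distrib]
    ring

open Matrix in
/-- The random Schroedinger integrand. -/
def GB {α : Type} [Fintype α] [DecidableEq α] (W : Matrix α α ℝ) (η : α → ℝ) (b : α → ℝ) : ENNReal :=
  {b : α → ℝ | (diagonal b - W).PosDef}.indicator (fun b =>
    ENNReal.ofReal (Real.exp (-(1/2) * (1 ⬝ᵥ (diagonal b - W) *ᵥ 1 + η ⬝ᵥ (diagonal b - W)⁻¹ *ᵥ η
      - 2 * (η ⬝ᵥ 1))) / √((diagonal b - W).det))) b

open Matrix in
lemma GB_meas {α : Type} [Fintype α] [DecidableEq α] (W : Matrix α α ℝ) (hW : W.IsHermitian) (η : α → ℝ) :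
    Measurable (GB W η) := by
  have hc : Continuous (fun b : α → ℝ => diagonal b - W) := by fun_prop
  have hdet : Continuous (fun b : α → ℝ => (diagonal b - W).det) := hc.matrix_det
  have hinv : ∀ i j, Measurable (fun b : α → ℝ => (diagonal b - W)⁻¹ i j) := by
    intro i j
    simp only [Matrix.inv_def, Ring.inverse_eq_inv', Matrix.smul_apply, smul_eq_mul]
    exact (hdet.measurable.inv).mul (hc.matrix_adjugate.matrix_elem i j).measurable
  unfold GB
  apply Measurable.indicator
  · apply Measurable.ennreal_ofReal
    apply Measurable.div _ hdet.measurable.sqrt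
    apply Measurable.exp
    apply Measurable.const_mul
    apply Measurable.sub_const
    apply Measurable.add
    · apply Continuous.measurable
      fun_prop
    · simp only [dotProduct, mulVec]
      refine Finset.measurable_sum _ fun i _ => Measurable.const_mul ?_ _
      exact Finset.measurable_sum _ fun j _ => (hinv i j).mul_const _
  · have : {b : α → ℝ | (diagonal b - W).PosDef} =
        (⋂ x : α → ℝ, {b | 0 ≤ x ⬝ᵥ (diagonal b - W) *ᵥ x}) ∩ {b | (diagonal b - W).det ≠ 0} := by
      ext b
      have hh : (diagonal b - W).IsHermitian := (isHermitian_diagonal b).sub hW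
      simp only [Set.mem_ofPred_eq, Set.mem_inter_iff, Set.mem_iInter]
      constructor
      · intro h
        exact ⟨fun x => by simpa using h.posSemidef.dotProduct_mulVec_nonneg x, h.det_pos.ne'⟩
      · rintro ⟨h1, h2⟩
        exact (PosSemidef.posDef_iff_det_ne_zero (.of_dotProduct_mulVec_nonneg hh (by simpa using h1))).2 h2
    rw [this]
    apply MeasurableSet.inter
    · apply IsClosed.measurableSet
      apply isClosed_iInter
      intro x
      apply isClosed_le continuous_const
      fun_prop
    · exact (isOpen_ne_fun hdet continuous_const).measurableSet

/-- The integral bound for the random Schroedinger integrand. -/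
def PB (α : Type) [Fintype α] : Prop := ∀ (_ : DecidableEq α) (W : Matrix α α ℝ), W.IsHermitian →
  ∀ η : α → ℝ, ∫⁻ b, GB W η b ≤ ENNReal.ofReal (√(2*Real.pi)) ^ (Fintype.card α)

open Matrix in
lemma PB_equiv (α β : Type) [Fintype α] [Fintype β] (e : α ≃ β) (h : PB α) : PB β := by
  intro _ W hW η
  have instα : DecidableEq α := Classical.decEq α
  rw [(volume_measurePreserving_piCongrLeft (fun _ => ℝ) e).lintegral_map_equiv _]
  rw [← Fintype.card_congr e]
  refine le_trans (le_of_eq ?_) (h instα (W.submatrix e e) (hW.submatrix e) (η ∘ e))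
  congr 1; ext b
  have hb : ∀ i, (MeasurableEquiv.piCongrLeft (fun _ => ℝ) e) b (e i) = b i := fun i =>
    MeasurableEquiv.piCongrLeft_apply_apply ..
  set b' : β → ℝ := (MeasurableEquiv.piCongrLeft (fun _ => ℝ) e) b
  have hM : diagonal b - W.submatrix e e = (diagonal b' - W).submatrix e e := by
    ext i j
    simp [diagonal_apply, hb]
  unfold GB
  have hpd : (diagonal b - W.submatrix e e).PosDef ↔ (diagonal b' - W).PosDef := by
    rw [hM]
    constructor
    · intro h
      have := h.submatrix e.symm.injective
      simpa using this
    · intro h; exact h.submatrix e.injective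
  by_cases hp : (diagonal b' - W).PosDef
  · rw [Set.indicator_of_mem (by exact hp), Set.indicator_of_mem (by exact hpd.2 hp)]
    rw [hM, det_submatrix_equiv_self, inv_submatrix_equiv]
    congr 5
    · congr 1
      · rw [submatrix_mulVec_equiv]
        rw [show (1 : α → ℝ) = (1 : β → ℝ) ∘ e from rfl]
        rw [show ((1 : β → ℝ) ∘ e) ∘ e.symm = 1 from rfl, comp_equiv_dotProduct_comp_equiv]
      · rw [submatrix_mulVec_equiv, Function.comp_assoc, Equiv.self_comp_symm, Function.comp_id, comp_equiv_dotProduct_comp_equiv]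
    · rw [show (1 : α → ℝ) = (1 : β → ℝ) ∘ e from rfl, comp_equiv_dotProduct_comp_equiv]
  · rw [Set.indicator_of_notMem (by exact hp), Set.indicator_of_notMem (by exact fun h => hp (hpd.1 h))]

open Matrix in
lemma GB_step {α : Type} [Fintype α] [DecidableEq α] (W : Matrix (Unit ⊕ α) (Unit ⊕ α) ℝ)
    (hW : W.IsHermitian) (η : Unit ⊕ α → ℝ) (b0 : ℝ) (b' : α → ℝ) :
    let W' := W.toBlocks₂₂
    let w : α → ℝ := fun j => W (.inl ()) (.inr j)
    let K := (diagonal b' - W')⁻¹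
    let c := η (.inl ()) + w ⬝ᵥ K *ᵥ (η ∘ Sum.inr)
    GB W η (Sum.elim (fun _ => b0) b') ≤ GB W' (η ∘ Sum.inr + w) b' *
      (ENNReal.ofReal (Real.exp c) * (Set.Ioi (0:ℝ)).indicator
        (fun x => ENNReal.ofReal (Real.exp (-(1/2)*(x + c^2/x)) / √x))
        (b0 - (W (.inl ()) (.inl ()) + w ⬝ᵥ K *ᵥ w))) := by
  intro W' w K c
  set H : Matrix (Unit ⊕ α) (Unit ⊕ α) ℝ := diagonal (Sum.elim (fun _ => b0) b') - W with hHdef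
  by_cases hp : H.PosDef
  swap
  · unfold GB
    rw [Set.indicator_of_notMem (by exact hp)]
    exact zero_le
  have hp' : (diagonal b' - W').PosDef := by
    have := hp.submatrix (e := Sum.inr) Sum.inr_injective
    convert this using 1
    ext i j
    simp [hHdef, W', toBlocks₂₂, diagonal_apply]
  have hHe : H = fromBlocks (of fun _ _ : Unit => b0 - W (.inl ()) (.inl ())) (of fun (_ : Unit) j => -w j)
      (of fun i (_ : Unit) => -w i) (diagonal b' - W') := by
    ext i j
    rcases i with i | i <;> rcases j with j | j
    · simp [hHdef]
    · simp [hHdef, w]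
    · have := hW.apply (.inr i) (.inl j)
      simp only [star_trivial] at this
      simp [hHdef, w, this]
    · simp [hHdef, W', toBlocks₂₂, diagonal_apply]
  have hη : η = Sum.elim (fun _ => η (.inl ())) (η ∘ Sum.inr) := by
    ext i; rcases i <;> rfl
  obtain ⟨h1, h2, h3, h4⟩ := schur (diagonal b' - W') hp' w (η ∘ Sum.inr) (b0 - W (.inl ()) (.inl ()))
    (η (.inl ())) (hHe ▸ hp)
  rw [← hHe] at h1 h3 h4
  rw [← hη] at h3
  have hsym : (η ∘ Sum.inr) ⬝ᵥ K *ᵥ w = w ⬝ᵥ K *ᵥ (η ∘ Sum.inr) := by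
    have hs : Kᵀ = K := by
      have := hp'.inv.1
      rwa [IsHermitian, conjTranspose_eq_transpose_of_trivial] at this
    rw [dotProduct_mulVec, dotProduct_comm, ← mulVec_transpose, hs]
  set x := b0 - (W (.inl ()) (.inl ()) + w ⬝ᵥ K *ᵥ w) with hx
  have hxx : b0 - W (.inl ()) (.inl ()) - w ⬝ᵥ K *ᵥ w = x := by rw [hx]; ring
  change 0 < b0 - W (.inl ()) (.inl ()) - w ⬝ᵥ K *ᵥ w at h2
  change H.det = _ * (b0 - W (.inl ()) (.inl ()) - w ⬝ᵥ K *ᵥ w) at h1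
  change η ⬝ᵥ H⁻¹ *ᵥ η = (η ∘ Sum.inr) ⬝ᵥ K *ᵥ (η ∘ Sum.inr) + c^2/(b0 - W (.inl ()) (.inl ()) - w ⬝ᵥ K *ᵥ w) at h3
  rw [hxx] at h1 h2 h3
  unfold GB
  rw [Set.indicator_of_mem (by exact hp), Set.indicator_of_mem (by exact hp'), Set.indicator_of_mem (by exact h2)]
  have hd := hp'.det_pos
  rw [← ENNReal.ofReal_mul (Real.exp_pos _).le, ← ENNReal.ofReal_mul (by positivity)]
  apply le_of_eq
  congr 1
  rw [← hHdef, h1, h3, h4, Real.sqrt_mul hd.le]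
  have h5 : η ⬝ᵥ 1 = η (.inl ()) + (η ∘ Sum.inr) ⬝ᵥ 1 := by
    simp [dotProduct]
  change _ = Real.exp (-(1/2) * (1 ⬝ᵥ (diagonal b' - W') *ᵥ 1 + (η ∘ Sum.inr + w) ⬝ᵥ K *ᵥ (η ∘ Sum.inr + w)
      - 2 * ((η ∘ Sum.inr + w) ⬝ᵥ 1))) / _ * _
  rw [h5, mulVec_add, dotProduct_add, add_dotProduct, add_dotProduct, add_dotProduct, hsym]
  rw [div_mul_eq_mul_div, mul_div_assoc', mul_div_assoc', div_div, ← Real.exp_add, ← Real.exp_add,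
    mul_comm (√x)]
  congr 2
  have : b0 = x + W (.inl ()) (.inl ()) + w ⬝ᵥ K *ᵥ w := by rw [hx]; ring
  simp only [c]
  rw [this]
  ring

open Matrix in
lemma PB_sum (α : Type) [Fintype α] (h : PB α) : PB (Unit ⊕ α) := by
  intro inst W hW η
  classical
  obtain rfl : inst = instDecidableEqSum := Subsingleton.elim _ _
  rw [← (volume_measurePreserving_sumPiEquivProdPi_symm (fun _ : Unit ⊕ α => ℝ)).lintegral_comp_emb
    (MeasurableEquiv.measurableEmbedding _)]
  have hm := GB_meas W hW η
  rw [Measure.volume_eq_prod, lintegral_prod_symm]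
  swap
  · exact (hm.comp (MeasurableEquiv.measurable _)).aemeasurable
  have hW' : W.toBlocks₂₂.IsHermitian := by
    ext i j
    simpa [toBlocks₂₂] using hW.apply (.inr i) (.inr j)
  set w : α → ℝ := fun j => W (.inl ()) (.inr j)
  calc _ ≤ ∫⁻ b', GB W.toBlocks₂₂ (η ∘ Sum.inr + w) b' * ENNReal.ofReal (√(2*Real.pi)) := by
        apply lintegral_mono
        intro b'
        dsimp only
        rw [← ((volume_preserving_funUnique Unit ℝ).symm _).lintegral_comp_emb (MeasurableEquiv.measurableEmbedding _)]
        set K := (diagonal b' - W.toBlocks₂₂)⁻¹ with hK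
        set c := η (.inl ()) + w ⬝ᵥ K *ᵥ (η ∘ Sum.inr) with hc
        calc _ ≤ ∫⁻ b0, GB W.toBlocks₂₂ (η ∘ Sum.inr + w) b' *
                (ENNReal.ofReal (Real.exp c) * (Set.Ioi (0:ℝ)).indicator
                (fun x => ENNReal.ofReal (Real.exp (-(1/2)*(x + c^2/x)) / √x))
                (b0 - (W (.inl ()) (.inl ()) + w ⬝ᵥ K *ᵥ w))) := by
              apply lintegral_mono
              intro b0
              refine le_trans (le_of_eq (congrArg (GB W η) ?_)) (GB_step W hW η b0 b')
              ext i
              rcases i <;> rfl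
          _ ≤ _ := by
              rw [lintegral_const_mul', lintegral_const_mul' _ _ ENNReal.ofReal_ne_top,
                lintegral_sub_right_eq_self (fun y => (Set.Ioi (0:ℝ)).indicator
                (fun x => ENNReal.ofReal (Real.exp (-(1/2)*(x + c^2/x)) / √x)) y),
                lintegral_indicator measurableSet_Ioi]
              · gcongr
                refine (mul_le_mul_right (lemA c) _).trans (le_of_eq ?_)
                rw [← ENNReal.ofReal_mul (Real.exp_pos _).le]
                congr 1
                rw [mul_left_comm, ← Real.exp_add]; simp
              · unfold GB
                rw [Set.indicator_apply]
                split_ifs <;> simp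
    _ ≤ _ := by
        rw [lintegral_mul_const' _ _ ENNReal.ofReal_ne_top]
        rw [Fintype.card_sum, Fintype.card_unit, add_comm 1, pow_succ]
        gcongr
        exact h _ _ hW' _

lemma PB_all (α : Type) [Fintype α] : PB α := by
  refine Fintype.induction_empty_option (P := fun α _ => PB α) ?_ ?_ ?_ α
  · intro α β _ e h
    classical
    let _ := Fintype.ofEquiv β e.symm
    exact PB_equiv α β e h
  · intro _ W hW η
    rw [lintegral_unique]
    simp only [Fintype.card_pempty, pow_zero]
    have : volume (Set.univ : Set (PEmpty.{1} → ℝ)) = 1 := by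
      simp [volume_pi]
    rw [this, mul_one]
    unfold GB
    refine le_trans (Set.indicator_le_self _ _ _) ?_
    simp
  · intro α _ h
    exact PB_equiv _ _ ((Equiv.optionEquivSumPUnit α).trans (Equiv.sumComm _ _)).symm (PB_sum α h)

open Matrix in
/-- The weighted operator. -/
def DW {ι : Type} [Fintype ι] [DecidableEq ι] (W : Matrix ι ι ℝ) (η : ι → ℝ) (t : ι → ℝ) : Matrix ι ι ℝ :=
  diagonal (fun i => ∑ k, W i k * Real.exp (t i + t k) + η i * Real.exp (t i)) -
    of (fun i j => W i j * Real.exp (t i + t j))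

section
variable {ι : Type} [Fintype ι] [DecidableEq ι] (W : Matrix ι ι ℝ) (η : ι → ℝ)
open Matrix

lemma DW_quad (hW : W.IsHermitian) (t v : ι → ℝ) : v ⬝ᵥ DW W η t *ᵥ v =
    (1/2) * ∑ i, ∑ j, W i j * Real.exp (t i + t j) * (v i - v j)^2 + ∑ i, η i * Real.exp (t i) * v i ^2 := by
  have hs : ∀ i j, W j i = W i j := fun i j => by simpa using hW.apply i j
  have e1 : v ⬝ᵥ DW W η t *ᵥ v = ∑ i, ∑ j, W i j * Real.exp (t i + t j) * (v i ^2 - v i * v j) +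
      ∑ i, η i * Real.exp (t i) * v i ^2 := by
    unfold DW
    rw [sub_mulVec, dotProduct_sub]
    simp only [dotProduct, mulVec_diagonal]
    rw [← Finset.sum_sub_distrib, ← Finset.sum_add_distrib]
    refine Finset.sum_congr rfl fun i _ => ?_
    simp only [mulVec, dotProduct, of_apply, mul_sub, Finset.sum_sub_distrib, Finset.mul_sum, add_mul, mul_add, Finset.sum_mul]
    rw [add_sub_right_comm]
    congr 1
    · congr 1 <;> exact Finset.sum_congr rfl fun j _ => by ring
    · ring
  rw [e1]
  congr 1
  have e2 : ∑ i, ∑ j, W i j * Real.exp (t i + t j) * (v i ^2 - v i * v j) =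
      ∑ i, ∑ j, W i j * Real.exp (t i + t j) * (v j ^2 - v i * v j) := by
    rw [Finset.sum_comm]
    refine Finset.sum_congr rfl fun i _ => Finset.sum_congr rfl fun j _ => ?_
    rw [hs, add_comm (t j)]; ring
  have e3 : ∑ i, ∑ j, W i j * Real.exp (t i + t j) * (v i - v j)^2 =
      ∑ i, ∑ j, W i j * Real.exp (t i + t j) * (v i ^2 - v i * v j) +
      ∑ i, ∑ j, W i j * Real.exp (t i + t j) * (v j ^2 - v i * v j) := by
    simp only [← Finset.sum_add_distrib]
    refine Finset.sum_congr rfl fun i _ => Finset.sum_congr rfl fun j _ => ?_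
    ring
  rw [e3, ← e2]; ring

lemma DW_herm (hW : W.IsHermitian) (t : ι → ℝ) : (DW W η t).IsHermitian := by
  have hs : ∀ i j, W j i = W i j := fun i j => by simpa using hW.apply i j
  apply (isHermitian_diagonal _).sub
  ext i j
  simp [hs i j, add_comm]

lemma DW_posDef (hW : W.IsHermitian) (hW0 : ∀ i j, 0 ≤ W i j) (hη : ∀ i, 0 < η i) (t : ι → ℝ) :
    (DW W η t).PosDef := by
  refine .of_dotProduct_mulVec_pos (DW_herm W η hW t) fun v hv => ?_
  rw [star_trivial, DW_quad W η hW]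
  obtain ⟨i, hi⟩ := Function.ne_iff.1 hv
  have h1 : 0 ≤ ∑ i, ∑ j, W i j * Real.exp (t i + t j) * (v i - v j)^2 :=
    Finset.sum_nonneg fun i _ => Finset.sum_nonneg fun j _ => by have := hW0 i j; positivity
  have h2 : 0 < ∑ i, η i * Real.exp (t i) * v i ^2 := by
    refine Finset.sum_pos' (fun i _ => by have := hη i; positivity) ⟨i, Finset.mem_univ _, ?_⟩
    have := hη i
    have : v i ≠ 0 := hi
    positivity
  linarith

/-- Change of variables. -/
def phi (t : ι → ℝ) (i : ι) : ℝ := ∑ k, W i k * Real.exp (t k - t i) + η i * Real.exp (-t i)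

lemma H_eq (t : ι → ℝ) : diagonal (phi W η t) - W =
    diagonal (fun i => Real.exp (-t i)) * DW W η t * diagonal (fun i => Real.exp (-t i)) := by
  ext i j
  rw [mul_diagonal, diagonal_mul]
  simp only [DW, Matrix.sub_apply, diagonal_apply, of_apply]
  have h2 : ∀ k, Real.exp (t k - t i) = Real.exp (-t i) * Real.exp (t i + t k) * Real.exp (-t i) := by
    intro k; rw [← Real.exp_add, ← Real.exp_add]; congr 1; ring
  have h3 : W i j = Real.exp (-t i) * (W i j * Real.exp (t i + t j)) * Real.exp (-t j) := by
    have : Real.exp (-t i) * Real.exp (t i + t j) * Real.exp (-t j) = 1 := by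
      rw [← Real.exp_add, ← Real.exp_add]; simp
    linear_combination (- W i j) * this
  have h4 : Real.exp (-t i) * Real.exp (t i) = 1 := by rw [← Real.exp_add]; simp
  by_cases h : i = j
  · subst h
    simp only [if_true, phi]
    rw [mul_sub, sub_mul, ← h3, mul_add, add_mul, Finset.mul_sum, Finset.sum_mul]
    congr 2
    · refine Finset.sum_congr rfl fun k _ => ?_
      rw [h2]; ring
    · linear_combination (-η i * Real.exp (-t i)) * h4
  · simp only [if_neg h]
    rw [zero_sub, zero_sub, mul_neg, neg_mul, ← h3]

lemma H_posDef (hW : W.IsHermitian) (hW0 : ∀ i j, 0 ≤ W i j) (hη : ∀ i, 0 < η i) (t : ι → ℝ) :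
    (diagonal (phi W η t) - W).PosDef := by
  rw [H_eq]
  have := (DW_posDef W η hW hW0 hη t).conjTranspose_mul_mul_same (B := diagonal (fun i => Real.exp (-t i))) ?_
  · rwa [diagonal_conjTranspose, star_trivial] at this
  · apply mulVec_injective_of_isUnit
    rw [isUnit_diagonal, Pi.isUnit_iff]
    intro i; exact (Real.exp_pos _).ne'.isUnit

lemma H_det (t : ι → ℝ) : (diagonal (phi W η t) - W).det =
    (∏ i, Real.exp (-t i))^2 * (DW W η t).det := by
  rw [H_eq, det_mul, det_mul, det_diagonal]; ring

lemma H_mulVec (t : ι → ℝ) : (diagonal (phi W η t) - W) *ᵥ (fun i => Real.exp (t i)) = η := by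
  ext i
  rw [sub_mulVec, Pi.sub_apply, mulVec_diagonal]
  simp only [phi, mulVec, dotProduct, add_mul, Finset.sum_mul]
  have : ∀ k, W i k * Real.exp (t k - t i) * Real.exp (t i) = W i k * Real.exp (t k) := by
    intro k; rw [mul_assoc, ← Real.exp_add]; simp
  simp only [this]
  rw [mul_assoc, ← Real.exp_add]; simp

lemma Hinv_mulVec (hW : W.IsHermitian) (hW0 : ∀ i j, 0 ≤ W i j) (hη : ∀ i, 0 < η i) (t : ι → ℝ) :
    (diagonal (phi W η t) - W)⁻¹ *ᵥ η = (fun i => Real.exp (t i)) := by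
  have hi := Matrix.nonsing_inv_mul _ ((H_posDef W η hW hW0 hη t).isUnit.map detMonoidHom)
  have h := congrArg (fun v => (diagonal (phi W η t) - W)⁻¹ *ᵥ v) (H_mulVec W η t)
  simp only [mulVec_mulVec] at h
  rw [hi, one_mulVec] at h
  exact h.symm

lemma phi_inj (hW : W.IsHermitian) (hW0 : ∀ i j, 0 ≤ W i j) (hη : ∀ i, 0 < η i) :
    Function.Injective (phi W η) := by
  intro t t' h
  have h1 := Hinv_mulVec W η hW hW0 hη t
  rw [h, Hinv_mulVec W η hW hW0 hη t'] at h1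
  ext i
  exact (Real.exp_injective (congrFun h1 i)).symm

/-- The Jacobian. -/
def Jac (t : ι → ℝ) : (ι → ℝ) →L[ℝ] (ι → ℝ) :=
  LinearMap.toContinuousLinearMap (toLin' (-(diagonal (fun i => Real.exp (-t i) ^ 2) * DW W η t)))

lemma phi_deriv (t : ι → ℝ) : HasFDerivAt (phi W η) (Jac W η t) t := by
  rw [hasFDerivAt_pi']
  intro i
  have hp : ∀ k, HasFDerivAt (fun t : ι → ℝ => t k) (ContinuousLinearMap.proj (R := ℝ) (φ := fun _ : ι => ℝ) k) t :=
    fun k => (ContinuousLinearMap.proj (R := ℝ) (φ := fun _ : ι => ℝ) k).hasFDerivAt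
  have h := (HasFDerivAt.fun_sum (u := Finset.univ) fun k _ => (((hp k).sub (hp i)).exp.const_mul (W i k))).add
    ((hp i).neg.exp.const_mul (η i))
  refine h.congr_fderiv ?_
  ext v
  simp only [Jac, ContinuousLinearMap.comp_apply, ContinuousLinearMap.proj_apply, LinearMap.coe_toContinuousLinearMap', toLin'_apply, neg_mulVec, Pi.neg_apply, ← mulVec_mulVec, mulVec_diagonal]
  simp only [DW, sub_mulVec, Pi.sub_apply, mulVec_diagonal]
  simp only [mulVec, dotProduct, of_apply]
  simp only [_root_.add_apply, _root_.sum_apply, _root_.smul_apply, _root_.sub_apply, _root_.neg_apply, ContinuousLinearMap.proj_apply, smul_eq_mul]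
  have h2 : ∀ k, Real.exp (t k - t i) = Real.exp (-t i)^2 * Real.exp (t i + t k) := by
    intro k; rw [sq, ← Real.exp_add, ← Real.exp_add]; congr 1; ring
  have h4 : Real.exp (-t i) * Real.exp (t i) = 1 := by rw [← Real.exp_add]; simp
  have h5 : Real.exp (-t i) = Real.exp (-t i)^2 * Real.exp (t i) := by
    linear_combination (-Real.exp (-t i)) * h4
  simp only [h2, mul_sub, Finset.sum_sub_distrib, add_mul, Finset.sum_mul, mul_add, Finset.mul_sum]
  have e1 : ∑ x, W i x * (Real.exp (-t i) ^ 2 * Real.exp (t i + t x) * v i) =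
    ∑ x, Real.exp (-t i) ^ 2 * (W i x * Real.exp (t i + t x) * v i) :=
    Finset.sum_congr rfl fun j _ => by ring
  have e2 : ∑ x, W i x * (Real.exp (-t i) ^ 2 * Real.exp (t i + t x) * v x) =
    ∑ x, Real.exp (-t i) ^ 2 * (W i x * Real.exp (t i + t x) * v x) :=
    Finset.sum_congr rfl fun j _ => by ring
  rw [e1, e2]
  linear_combination (-η i * v i) * h5

lemma Jac_det (hW : W.IsHermitian) (hW0 : ∀ i j, 0 ≤ W i j) (hη : ∀ i, 0 < η i) (t : ι → ℝ) :
    |(Jac W η t).det| = (∏ i, Real.exp (-t i))^2 * (DW W η t).det := by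
  unfold Jac
  rw [LinearMap.det_toContinuousLinearMap, LinearMap.det_toLin', det_neg, det_mul, det_diagonal, abs_mul, abs_pow]
  have := (DW_posDef W η hW hW0 hη t).det_pos
  rw [abs_neg, abs_one, one_pow, one_mul, Finset.prod_pow, abs_of_nonneg]
  positivity

end

section
variable {ι : Type} [Fintype ι] [DecidableEq ι] (W : Matrix ι ι ℝ) (η : ι → ℝ)
open Matrix

/-- The t-part of the action. -/
def act (t : ι → ℝ) : ℝ := -((1/2) * ∑ i, ∑ j, W i j * (Real.cosh (t i - t j) - 1)) - ∑ i, η i * (Real.cosh (t i) - 1)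

lemma lemC (hW : W.IsHermitian) (hW0 : ∀ i j, 0 ≤ W i j) (hη : ∀ i, 0 < η i) :
    ∫⁻ t : ι → ℝ, ENNReal.ofReal (√(DW W η t).det * Real.exp (act W η t) * ∏ i, Real.exp (-t i))
      ≤ ENNReal.ofReal (√(2*Real.pi)) ^ (Fintype.card ι) := by
  have hs : ∀ i j, W j i = W i j := fun i j => by simpa using hW.apply i j
  have key := lintegral_image_eq_lintegral_abs_det_fderiv_mul volume MeasurableSet.univ
    (fun t _ => (phi_deriv W η t).hasFDerivWithinAt) ((phi_inj W η hW hW0 hη).injOn) (GB W η)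
  have hB : ∫⁻ b, GB W η b ≤ ENNReal.ofReal (√(2*Real.pi)) ^ (Fintype.card ι) := by
    have h0 := PB_all ι
    unfold PB at h0
    exact h0 inferInstance W hW η
  refine le_trans (le_trans (le_of_eq ?_) (key.symm.le.trans (setLIntegral_le_lintegral _ _))) hB
  rw [setLIntegral_univ]
  congr 1; ext t
  have hp := H_posDef W η hW hW0 hη t
  have hd := (DW_posDef W η hW hW0 hη t).det_pos
  unfold GB
  rw [Set.indicator_of_mem (by exact hp), Jac_det W η hW hW0 hη, H_det, Hinv_mulVec W η hW hW0 hη]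
  rw [← ENNReal.ofReal_mul (by positivity)]
  congr 1
  have hP : 0 < ∏ i, Real.exp (-t i) := by positivity
  set P := ∏ i, Real.exp (-t i)
  set d := (DW W η t).det
  rw [Real.sqrt_mul (by positivity), Real.sqrt_sq hP.le]
  have hexp : -(1/2) * (1 ⬝ᵥ (diagonal (phi W η t) - W) *ᵥ 1 + η ⬝ᵥ (fun i => Real.exp (t i)) - 2 * η ⬝ᵥ 1)
      = act W η t := by
    have e1 : 1 ⬝ᵥ (diagonal (phi W η t) - W) *ᵥ 1 = ∑ i, ∑ j, W i j * (Real.exp (t j - t i) - 1) + ∑ i, η i * Real.exp (-t i) := by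
      rw [sub_mulVec, dotProduct_sub]
      simp [dotProduct, diagonal_apply, phi, mulVec, mul_sub, Finset.sum_add_distrib, Finset.sum_sub_distrib]
      ring
    have e2 : ∑ i, ∑ j, W i j * (Real.exp (t j - t i) - 1) = ∑ i, ∑ j, W i j * (Real.exp (t i - t j) - 1) := by
      rw [Finset.sum_comm]
      refine Finset.sum_congr rfl fun i _ => Finset.sum_congr rfl fun j _ => ?_
      rw [hs]
    have e3 : 2 * ∑ i, ∑ j, W i j * (Real.cosh (t i - t j) - 1) =
        ∑ i, ∑ j, W i j * (Real.exp (t j - t i) - 1) + ∑ i, ∑ j, W i j * (Real.exp (t i - t j) - 1) := by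
      simp only [Finset.mul_sum, ← Finset.sum_add_distrib]
      refine Finset.sum_congr rfl fun i _ => Finset.sum_congr rfl fun j _ => ?_
      rw [Real.cosh_eq, neg_sub]; ring
    have e4 : 2 * ∑ i, η i * (Real.cosh (t i) - 1) = ∑ i, η i * Real.exp (-t i) + ∑ i, η i * Real.exp (t i) - 2 * ∑ i, η i := by
      simp only [Finset.mul_sum, ← Finset.sum_add_distrib, ← Finset.sum_sub_distrib]
      refine Finset.sum_congr rfl fun i _ => ?_
      rw [Real.cosh_eq]; ring
    rw [e1]
    unfold act
    have e5 : η ⬝ᵥ 1 = ∑ i, η i := by simp [dotProduct]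
    have e6 : η ⬝ᵥ (fun i => Real.exp (t i)) = ∑ i, η i * Real.exp (t i) := rfl
    rw [e5, e6]
    linarith
  rw [hexp]
  have hsd : √d * √d = d := Real.mul_self_sqrt hd.le
  have hsd0 : 0 < √d := Real.sqrt_pos.2 hd
  rw [mul_div_assoc', eq_div_iff (by positivity)]
  linear_combination (Real.exp (act W η t) * P^2) * hsd

lemma gauss_pi : ∫⁻ s : ι → ℝ, ENNReal.ofReal (Real.exp (-(1/2) * (s ⬝ᵥ s))) =
    ENNReal.ofReal (√(2*Real.pi)) ^ (Fintype.card ι) := by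
  have h := integral_gaussian (1/2)
  have hi := integrable_exp_neg_mul_sq (b := 1/2) (by norm_num)
  have e : (fun s : ι → ℝ => Real.exp (-(1/2) * (s ⬝ᵥ s))) = fun s : ι → ℝ => ∏ i, Real.exp (-(1/2) * (s i)^2) := by
    ext s
    rw [← Real.exp_sum, dotProduct, Finset.mul_sum]
    congr 1; refine Finset.sum_congr rfl fun i _ => by ring
  have e' := congrFun e
  simp only [e']
  rw [← ofReal_integral_eq_lintegral_ofReal]
  · rw [integral_fintype_prod_volume_eq_pow (f := fun x : ℝ => Real.exp (-(1/2) * x^2)), h, ENNReal.ofReal_pow (by positivity)]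
    congr 3; ring
  · exact Integrable.fintype_prod (f := fun (_ : ι) (x : ℝ) => Real.exp (-(1/2) * x^2)) (fun _ => hi)
  · exact Filter.Eventually.of_forall fun v => by positivity

open scoped MatrixOrder in
lemma exists_sqrt (A : Matrix ι ι ℝ) (hA : A.PosDef) : ∃ B : Matrix ι ι ℝ, A = Bᵀ * B := by
  obtain ⟨B, hB⟩ := CStarAlgebra.nonneg_iff_eq_star_mul_self.mp hA.posSemidef.nonneg
  exact ⟨B, by rw [hB, star_eq_conjTranspose, conjTranspose_eq_transpose_of_trivial]⟩

lemma gauss_A (A : Matrix ι ι ℝ) (hA : A.PosDef) :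
    ∫⁻ s : ι → ℝ, ENNReal.ofReal (Real.exp (-(1/2) * (s ⬝ᵥ A *ᵥ s))) =
    ENNReal.ofReal (1 / √A.det) * ENNReal.ofReal (√(2*Real.pi)) ^ (Fintype.card ι) := by
  obtain ⟨B, rfl⟩ := exists_sqrt A hA
  have hd := hA.det_pos
  rw [det_mul, det_transpose] at hd ⊢
  have hB : B.det ≠ 0 := fun h => by simp [h] at hd
  rw [Real.sqrt_mul_self_eq_abs, ← gauss_pi]
  have hm := Real.map_matrix_volume_pi_eq_smul_volume_pi hB
  have : ∫⁻ s : ι → ℝ, ENNReal.ofReal (Real.exp (-(1/2) * (s ⬝ᵥ s))) ∂(Measure.map (toLin' B) volume)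
    = ENNReal.ofReal |B.det⁻¹| * ∫⁻ s : ι → ℝ, ENNReal.ofReal (Real.exp (-(1/2) * (s ⬝ᵥ s))) := by
    rw [hm, lintegral_smul_measure, smul_eq_mul]
  rw [lintegral_map] at this
  · rw [one_div (|B.det|), ← abs_inv, ← this]
    congr 1; ext s
    congr 3
    rw [toLin'_apply, ← mulVec_mulVec, dotProduct_mulVec, vecMul_transpose]
  · have : Continuous (fun s : ι → ℝ => s ⬝ᵥ s) := by unfold dotProduct; fun_prop
    fun_prop
  · exact (LinearMap.continuous_of_finiteDimensional _).measurable

/-- Density of the model. -/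
def dens (t s : ι → ℝ) : ℝ := (DW W η t).det * Real.exp (
    -((1/2) * ∑ i, ∑ j, W i j * (Real.cosh (t i - t j) + (1 / 2) * (s i - s j) ^ 2 * Real.exp (t i + t j) - 1))
    - ∑ i, η i * (Real.cosh (t i) + (1/2) * (s i)^2 * Real.exp (t i) - 1)) * ∏ i, Real.exp (-t i)

lemma DW_cont : Continuous (fun t : ι → ℝ => DW W η t) := by
  unfold DW
  apply Continuous.sub
  · apply Continuous.matrix_diagonal
    fun_prop
  · apply continuous_matrix
    intro i j
    simp only [of_apply]
    fun_prop

lemma dens_cont : Continuous (fun p : (ι → ℝ) × (ι → ℝ) => dens W η p.1 p.2) := by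
  unfold dens
  have h := ((DW_cont W η).matrix_det).comp (continuous_fst (X := ι → ℝ) (Y := ι → ℝ))
  simp only [Function.comp_def] at h
  fun_prop

lemma lemD (hW : W.IsHermitian) (hW0 : ∀ i j, 0 ≤ W i j) (hη : ∀ i, 0 < η i) :
    ∫⁻ p : (ι → ℝ) × (ι → ℝ), ENNReal.ofReal (dens W η p.1 p.2)
      ≤ ENNReal.ofReal (2*Real.pi) ^ (Fintype.card ι) := by
  rw [Measure.volume_eq_prod, lintegral_prod _ (by exact (dens_cont W η).measurable.ennreal_ofReal.aemeasurable)]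
  have hc : ENNReal.ofReal (2*Real.pi) = ENNReal.ofReal (√(2*Real.pi)) * ENNReal.ofReal (√(2*Real.pi)) := by
    rw [← ENNReal.ofReal_mul (by positivity), Real.mul_self_sqrt (by positivity)]
  rw [hc, mul_pow]
  refine le_trans ?_ (mul_le_mul_left (lemC W η hW hW0 hη) _)
  rw [← lintegral_mul_const' _ _ (ENNReal.pow_ne_top ENNReal.ofReal_ne_top)]
  apply lintegral_mono
  intro t
  dsimp only
  have hpd := DW_posDef W η hW hW0 hη t
  have hd := hpd.det_pos
  have e : ∀ s, dens W η t s = ((DW W η t).det * Real.exp (act W η t) * ∏ i, Real.exp (-t i)) *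
      Real.exp (-(1/2) * (s ⬝ᵥ DW W η t *ᵥ s)) := by
    intro s
    unfold dens
    rw [DW_quad W η hW, mul_assoc, mul_assoc, mul_assoc, mul_comm (∏ i, _), ← mul_assoc (Real.exp _) (Real.exp _), ← Real.exp_add]
    congr 3
    unfold act
    have e1 : ∑ i, ∑ j, W i j * (Real.cosh (t i - t j) + (1 / 2) * (s i - s j) ^ 2 * Real.exp (t i + t j) - 1)
      = ∑ i, ∑ j, W i j * (Real.cosh (t i - t j) - 1) + (1/2) * ∑ i, ∑ j, W i j * Real.exp (t i + t j) * (s i - s j)^2 := by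
      simp only [Finset.mul_sum, ← Finset.sum_add_distrib]
      refine Finset.sum_congr rfl fun i _ => Finset.sum_congr rfl fun j _ => by ring
    have e2 : ∑ i, η i * (Real.cosh (t i) + (1/2) * (s i)^2 * Real.exp (t i) - 1) =
      ∑ i, η i * (Real.cosh (t i) - 1) + (1/2) * ∑ i, η i * Real.exp (t i) * s i ^2 := by
      simp only [Finset.mul_sum, ← Finset.sum_add_distrib]
      refine Finset.sum_congr rfl fun i _ => by ring
    rw [e1, e2]; ring
  simp only [e]
  have hpos : 0 ≤ (DW W η t).det * Real.exp (act W η t) * ∏ i, Real.exp (-t i) := by positivity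
  simp only [ENNReal.ofReal_mul hpos]
  rw [lintegral_const_mul' _ _ ENNReal.ofReal_ne_top, gauss_A _ hpd, ← mul_assoc, ← ENNReal.ofReal_mul hpos]
  apply le_of_eq
  congr 2
  have hsd : √(DW W η t).det * √(DW W η t).det = (DW W η t).det := Real.mul_self_sqrt hd.le
  have hsd0 : 0 < √(DW W η t).det := Real.sqrt_pos.2 hd
  rw [mul_one_div, div_eq_iff hsd0.ne']
  linear_combination -(Real.exp (act W η t) * ∏ i, Real.exp (-t i)) * hsd

end

section
variable {ι : Type} [Fintype ι] [DecidableEq ι] (W : Matrix ι ι ℝ) (η : ι → ℝ)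
open Matrix

/-- Symmetric edge matrix. -/
def EE (x y : ι) : Matrix ι ι ℝ := of fun i j =>
  (if i = x then (if j = y then 1 else 0) else 0) + (if i = y then (if j = x then 1 else 0) else 0)

lemma EE_sum (x y : ι) (f : ι → ι → ℝ) : ∑ i, ∑ j, EE x y i j * f i j = f x y + f y x := by
  simp only [EE, of_apply, add_mul, Finset.sum_add_distrib]
  simp [ite_mul]

lemma EE_sum1 (x y i : ι) (f : ι → ℝ) : ∑ j, EE x y i j * f j = (if i = x then f y else 0) + (if i = y then f x else 0) := by
  simp only [EE, of_apply, add_mul, Finset.sum_add_distrib]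
  congr 1
  · split_ifs <;> simp
  · split_ifs <;> simp

lemma EE_herm (x y : ι) : (EE x y).IsHermitian := by
  ext i j
  simp only [EE, conjTranspose_apply, of_apply, star_trivial]
  split_ifs <;> simp_all

lemma DW_add (x y : ι) (hxy : x ≠ y) (r : ℝ) (t : ι → ℝ) : DW (W + r • EE x y) η t = DW W η t +
    replicateCol Unit ((r * Real.exp (t x + t y)) • (Pi.single x 1 - Pi.single y 1 : ι → ℝ)) * replicateRow Unit (Pi.single x 1 - Pi.single y 1 : ι → ℝ) := by
  ext i j
  have h0 : ∑ k, (W + r • EE x y) i k * Real.exp (t i + t k) =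
     ∑ k, W i k * Real.exp (t i + t k) + r * ((if i = x then Real.exp (t i + t y) else 0) + (if i = y then Real.exp (t i + t x) else 0)) := by
    rw [← EE_sum1 x y i (fun k => Real.exp (t i + t k)), Finset.mul_sum, ← Finset.sum_add_distrib]
    refine Finset.sum_congr rfl fun k _ => ?_
    simp only [Matrix.add_apply, Matrix.smul_apply, smul_eq_mul]; ring
  unfold DW
  rw [Matrix.add_apply, Matrix.sub_apply, Matrix.sub_apply, diagonal_apply, diagonal_apply, h0]
  simp only [Matrix.add_apply, of_apply, Matrix.smul_apply, smul_eq_mul, mul_apply,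
    replicateCol_apply, replicateRow_apply, Pi.smul_apply, Pi.sub_apply, Pi.single_apply, Finset.univ_unique, Finset.sum_singleton, EE]
  by_cases hi : i = x
  · subst hi
    by_cases hj : j = i
    · subst hj; simp [hxy]; ring
    · by_cases hj2 : j = y
      · subst hj2; simp [hxy, hxy.symm]; ring
      · simp [hxy, hj, hj2, Ne.symm hj]
  · by_cases hi2 : i = y
    · subst hi2
      by_cases hj : j = i
      · subst hj; simp [hi, add_comm (t j)]; ring
      · by_cases hj2 : j = x
        · subst hj2; simp [hxy, hxy.symm, add_comm (t i)]; ring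
        · simp [hxy.symm, hj, hj2, Ne.symm hj]
    · simp [hi, hi2]

lemma det_rank1 (A : Matrix ι ι ℝ) (hA : A.PosDef) (k : ℝ) (u : ι → ℝ) :
    (A + replicateCol Unit (k • u) * replicateRow Unit u).det = A.det * (1 + k * (u ⬝ᵥ A⁻¹ *ᵥ u)) := by
  rw [det_add_replicateCol_mul_replicateRow (hA.det_pos.ne'.isUnit)]
  congr 1
  rw [det_unique]
  simp only [Matrix.add_apply, one_apply_eq]
  congr 1
  rw [Matrix.mul_assoc]
  simp only [Matrix.mul_apply, dotProduct, mulVec, Finset.mul_sum, replicateRow_apply, replicateCol_apply, Pi.smul_apply, smul_eq_mul]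
  refine Finset.sum_congr rfl fun i _ => Finset.sum_congr rfl fun j _ => ?_
  ring

lemma lemE (hW : W.IsHermitian) (hW0 : ∀ i j, 0 ≤ W i j) (hη : ∀ i, 0 < η i) (x y : ι) (hxy : x ≠ y) :
    ∫⁻ p : (ι → ℝ) × (ι → ℝ), ENNReal.ofReal (dens W η p.1 p.2 * Real.exp (W x y / 2 *
      (Real.cosh (p.1 x - p.1 y) + (1 / 2) * (p.2 x - p.2 y) ^ 2 * Real.exp (p.1 x + p.1 y) - 1)))
      ≤ 2 * ENNReal.ofReal (2*Real.pi) ^ (Fintype.card ι) := by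
  have hs : ∀ i j, W j i = W i j := fun i j => by simpa using hW.apply i j
  set c := W x y with hc
  set W0 := W + (-c) • EE x y with hW0d
  set W1 := W + (-c/2) • EE x y with hW1d
  have hc0 : 0 ≤ c := hW0 x y
  have hE0 : ∀ r, -c ≤ r → ∀ i j, 0 ≤ (W + r • EE x y) i j := by
    intro r hr i j
    simp only [Matrix.add_apply, Matrix.smul_apply, smul_eq_mul, EE, of_apply]
    have h1 := hW0 i j
    by_cases h : i = x ∧ j = y
    · obtain ⟨rfl, rfl⟩ := h
      simp [hxy]; linarith
    · by_cases h' : i = y ∧ j = x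
      · obtain ⟨rfl, rfl⟩ := h'
        have := hs j i
        simp [hxy.symm]; linarith
      · have e : (if i = x then (if j = y then (1:ℝ) else 0) else 0) + (if i = y then (if j = x then 1 else 0) else 0) = 0 := by
          split_ifs <;> simp_all
        rw [e]; simpa using h1
  have hH : ∀ r : ℝ, (W + r • EE x y).IsHermitian := fun r => by
    apply hW.add
    ext i j
    have := (EE_herm x y).apply i j
    simp only [star_trivial] at this
    simp [this]
  have hDE := lemD W1 η (hH _) (hE0 _ (by linarith)) hη
  refine le_trans ?_ (mul_le_mul_right hDE 2)
  rw [← lintegral_const_mul' _ _ (by simp)]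
  apply lintegral_mono
  rintro ⟨t, s⟩
  dsimp only
  rw [show (2 : ENNReal) = ENNReal.ofReal 2 by simp, ← ENNReal.ofReal_mul (by norm_num)]
  apply ENNReal.ofReal_le_ofReal
  have hpd := DW_posDef W0 η (hH _) (hE0 _ le_rfl) hη t
  have e0 : W = W0 + c • EE x y := by rw [hW0d]; module
  have e1 : W1 = W0 + (c/2) • EE x y := by rw [hW0d, hW1d]; module
  have d0 : (DW W η t).det = (DW W0 η t).det * (1 + (c * Real.exp (t x + t y)) * ((Pi.single x 1 - Pi.single y 1 : ι → ℝ) ⬝ᵥ (DW W0 η t)⁻¹ *ᵥ (Pi.single x 1 - Pi.single y 1 : ι → ℝ))) := by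
    conv_lhs => rw [e0]
    rw [DW_add _ _ _ _ hxy, det_rank1 _ hpd]
  have d1 : (DW W1 η t).det = (DW W0 η t).det * (1 + (c/2 * Real.exp (t x + t y)) * ((Pi.single x 1 - Pi.single y 1 : ι → ℝ) ⬝ᵥ (DW W0 η t)⁻¹ *ᵥ (Pi.single x 1 - Pi.single y 1 : ι → ℝ))) := by
    rw [e1, DW_add _ _ _ _ hxy, det_rank1 _ hpd]
  have hdet : (DW W η t).det ≤ 2 * (DW W1 η t).det := by
    have := hpd.det_pos
    have e : 2 * (DW W1 η t).det = (DW W η t).det + (DW W0 η t).det := by rw [d0, d1]; ring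
    linarith
  unfold dens
  set f : ι → ι → ℝ := fun i j => Real.cosh (t i - t j) + (1 / 2) * (s i - s j) ^ 2 * Real.exp (t i + t j) - 1 with hf
  have hfs : f y x = f x y := by
    simp only [hf]
    rw [← Real.cosh_neg, neg_sub, add_comm (t y)]; ring
  have hsum : ∑ i, ∑ j, W1 i j * f i j = ∑ i, ∑ j, W i j * f i j - c * f x y := by
    have := EE_sum x y f
    rw [hfs] at this
    have h2 : ∑ i, ∑ j, W1 i j * f i j = ∑ i, ∑ j, W i j * f i j + (-c/2) * ∑ i, ∑ j, EE x y i j * f i j := by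
      simp only [Finset.mul_sum, ← Finset.sum_add_distrib]
      refine Finset.sum_congr rfl fun i _ => Finset.sum_congr rfl fun j _ => ?_
      simp only [hW1d, Matrix.add_apply, Matrix.smul_apply, smul_eq_mul]; ring
    rw [h2, this]; ring
  set K := ∑ i, η i * (Real.cosh (t i) + (1/2) * (s i)^2 * Real.exp (t i) - 1)
  change (DW W η t).det * Real.exp (-((1/2) * ∑ i, ∑ j, W i j * f i j) - K) * (∏ i, Real.exp (-t i)) * Real.exp (c/2 * f x y)
    ≤ 2 * ((DW W1 η t).det * Real.exp (-((1/2) * ∑ i, ∑ j, W1 i j * f i j) - K) * (∏ i, Real.exp (-t i)))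
  rw [hsum]
  have he : Real.exp (-((1/2) * (∑ i, ∑ j, W i j * f i j - c * f x y)) - K) =
      Real.exp (-((1/2) * ∑ i, ∑ j, W i j * f i j) - K) * Real.exp (c/2 * f x y) := by
    rw [← Real.exp_add]; congr 1; ring
  rw [he]
  have hP : 0 < Real.exp (-((1/2) * ∑ i, ∑ j, W i j * f i j) - K) * Real.exp (c/2 * f x y) * ∏ i, Real.exp (-t i) := by positivity
  have := mul_le_mul_of_nonneg_right hdet hP.le
  linarith
end

section ShortScale

/-- Point of the upper half plane attached to a site. -/
def zz {L : ℕ} (t s : Torus L → ℝ) (k : Torus L) : UpperHalfPlane :=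
  UpperHalfPlane.mk ⟨s k, Real.exp (-t k)⟩ (Real.exp_pos _)

lemma Bq_cosh {L : ℕ} (t s : Torus L → ℝ) (x y : Torus L) : Bq t s x y = Real.cosh (dist (zz t s x) (zz t s y)) := by
  rw [UpperHalfPlane.cosh_dist']
  have h1 : ∀ k, (zz t s k).re = s k := fun k => rfl
  have h2 : ∀ k, (zz t s k).im = Real.exp (-t k) := fun k => rfl
  rw [h1, h1, h2, h2, Bq, Real.cosh_eq, neg_sub]
  simp only [Real.exp_sub, Real.exp_neg, Real.exp_add]
  have := Real.exp_pos (t x)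
  have := Real.exp_pos (t y)
  field_simp
  ring

lemma cosh_ge (d : ℝ) : d ^ 2 / 2 ≤ Real.cosh d - 1 := by
  have h1 : Real.cosh d = 1 + 2 * Real.sinh (d/2) ^ 2 := by
    have := Real.cosh_two_mul (d/2)
    have h2 := Real.cosh_sq (d/2)
    rw [show 2 * (d/2) = d by ring] at this
    linarith
  have h3 : |d/2| ≤ |Real.sinh (d/2)| := by
    rw [Real.abs_sinh]
    exact Real.self_le_sinh_iff.2 (abs_nonneg _)
  have h4 := sq_le_sq.2 h3
  nlinarith

lemma det_bound {L : ℕ} (t s : Torus L → ℝ) (p : ℕ → Torus L) (n : ℕ) (hn : 0 < n) (q b : ℝ) (hq : 0 ≤ q)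
    (hb : q * n ^ 2 ≤ b) :
    Bq t s (p 0) (p n) ^ q ≤ ∑ i ∈ Finset.range n, (1 / (n : ℝ)) * Real.exp (b * (Bq t s (p i) (p (i+1)) - 1)) := by
  have hn' : (0:ℝ) < n := by exact_mod_cast hn
  set d : ℕ → ℝ := fun i => dist (zz t s (p i)) (zz t s (p (i+1))) with hd
  have h1 : dist (zz t s (p 0)) (zz t s (p n)) ≤ ∑ i ∈ Finset.range n, d i :=
    dist_le_range_sum_dist (fun i => zz t s (p i)) n
  have hB : ∀ i, Bq t s (p i) (p (i+1)) = Real.cosh (d i) := fun i => Bq_cosh _ _ _ _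
  simp only [hB]
  set D := dist (zz t s (p 0)) (zz t s (p n)) with hD
  have hD0 : 0 ≤ D := dist_nonneg
  have h2 : D ^ 2 ≤ n * ∑ i ∈ Finset.range n, d i ^ 2 := by
    refine (pow_le_pow_left₀ hD0 h1 2).trans ?_
    have := sq_sum_le_card_mul_sum_sq (s := Finset.range n) (f := d)
    simpa using this
  have h3 : ∑ i ∈ Finset.range n, d i ^ 2 ≤ ∑ i ∈ Finset.range n, 2 * (Real.cosh (d i) - 1) :=
    Finset.sum_le_sum fun i _ => by have := cosh_ge (d i); linarith
  rw [← Finset.mul_sum] at h3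
  set S := ∑ i ∈ Finset.range n, (Real.cosh (d i) - 1) with hS
  have hS0 : 0 ≤ S := Finset.sum_nonneg fun i _ => by have := Real.one_le_cosh (d i); linarith
  have h4 : Bq t s (p 0) (p n) ^ q ≤ Real.exp (D ^ 2 / 2 * q) := by
    rw [Bq_cosh, Real.exp_mul]
    exact Real.rpow_le_rpow (Real.cosh_pos _).le (Real.cosh_le_exp_half_sq _) hq
  have h5 : D ^ 2 / 2 * q ≤ ∑ i ∈ Finset.range n, (1 / (n:ℝ)) * (b * (Real.cosh (d i) - 1)) := by
    rw [← Finset.mul_sum, ← Finset.mul_sum]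
    have h6 : D ^ 2 / 2 ≤ n * S := by nlinarith
    calc D ^ 2 / 2 * q ≤ n * S * q := mul_le_mul_of_nonneg_right h6 hq
      _ = (1 / (n:ℝ)) * ((q * n^2) * S) := by field_simp
      _ ≤ _ := by gcongr
  refine h4.trans ((Real.exp_le_exp.2 h5).trans ?_)
  have := convexOn_exp.map_sum_le (t := Finset.range n) (w := fun _ => 1 / (n:ℝ)) (p := fun i => b * (Real.cosh (d i) - 1))
    (fun _ _ => by positivity) (by simp [hn'.ne']) (fun _ _ => Set.mem_univ _)
  simpa using this

/-- The nearest-neighbor graph. -/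
def GG (L : ℕ) : SimpleGraph (Torus L) where
  Adj := NN
  symm := ⟨by
    rintro x y ⟨h, i, h1 | h1⟩
    · exact ⟨h.symm, i, Or.inr (by rw [h1]; simp)⟩
    · exact ⟨h.symm, i, Or.inl (by rw [h1]; simp)⟩⟩
  loopless := ⟨fun x h => h.1 rfl⟩

lemma NN_symm {L : ℕ} {x y : Torus L} (h : NN x y) : NN y x := (GG L).symm.symm _ _ h

lemma walk_pos (L : ℕ) (z : Torus (L+2)) (i : Fin 3) (k : ℕ) :
    ∃ w : (GG (L+2)).Walk z (z + (k : ZMod (L+2)) • unitVec (L+2) i), w.length = k := by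
  induction k with
  | zero => exact ⟨SimpleGraph.Walk.nil.copy rfl (by simp), by simp⟩
  | succ k ih =>
    obtain ⟨w, hw⟩ := ih
    have e : z + ((k + 1 : ℕ) : ZMod (L+2)) • unitVec (L+2) i = z + (k : ZMod (L+2)) • unitVec (L+2) i + unitVec (L+2) i := by
      push_cast; rw [add_smul, one_smul, add_assoc]
    rw [e]
    have hadj : (GG (L+2)).Adj (z + (k : ZMod (L+2)) • unitVec (L+2) i) (z + (k : ZMod (L+2)) • unitVec (L+2) i + unitVec (L+2) i) := by
      refine ⟨fun h => ?_, i, Or.inl rfl⟩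
      have h0 : unitVec (L+2) i = 0 := by simpa using h
      have h1 := congrFun h0 i
      have : Fact (1 < L + 2) := ⟨by omega⟩
      simp [unitVec] at h1
    exact ⟨w.concat hadj, by simp [hw]⟩

lemma walk_coord (L : ℕ) (z : Torus (L+2)) (i : Fin 3) (a : ZMod (L+2)) :
    ∃ w : (GG (L+2)).Walk z (z + a • unitVec (L+2) i), (w.length : ℝ) ≤ min (a.val : ℝ) (((L + 2 : ℕ) : ℝ) - a.val) := by
  have hv : a.val < L + 2 := ZMod.val_lt a
  rcases le_total (a.val : ℝ) (((L + 2 : ℕ) : ℝ) - a.val) with h | h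
  · rw [min_eq_left h]
    obtain ⟨w, hw⟩ := walk_pos L z i a.val
    exact ⟨w.copy rfl (by rw [ZMod.natCast_zmod_val]), by simp [hw]⟩
  · rw [min_eq_right h]
    obtain ⟨w, hw⟩ := walk_pos L (z + a • unitVec (L+2) i) i (L + 2 - a.val)
    have e : ((L + 2 - a.val : ℕ) : ZMod (L+2)) = -a := by
      rw [Nat.cast_sub hv.le, ZMod.natCast_zmod_val, ZMod.natCast_self, zero_sub]
    refine ⟨(w.copy rfl (by rw [e]; simp)).reverse, ?_⟩
    simp only [SimpleGraph.Walk.length_reverse, SimpleGraph.Walk.length_copy, hw]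
    rw [Nat.cast_sub hv.le]

lemma coord_le (L : ℕ) [NeZero L] (x y : Torus L) (i : Fin 3) :
    min ((x i - y i).val : ℝ) ((L : ℝ) - (x i - y i).val) ≤ torusDist x y := by
  unfold torusDist
  apply Real.le_sqrt_of_sq_le
  exact Finset.single_le_sum (f := fun i => (min ((x i - y i).val : ℝ) ((L : ℝ) - (x i - y i).val)) ^ 2)
    (fun _ _ => sq_nonneg _) (Finset.mem_univ i)

lemma exists_path (L : ℕ) (x y : Torus (L+2)) : ∃ (n : ℕ) (p : ℕ → Torus (L+2)), p 0 = x ∧ p n = y ∧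
    (∀ i < n, NN (p i) (p (i+1))) ∧ (n : ℝ) ≤ 3 * torusDist x y := by
  obtain ⟨w0, h0⟩ := walk_coord L y 0 (x 0 - y 0)
  obtain ⟨w1, h1⟩ := walk_coord L (y + (x 0 - y 0) • unitVec (L+2) 0) 1 (x 1 - y 1)
  obtain ⟨w2, h2⟩ := walk_coord L (y + (x 0 - y 0) • unitVec (L+2) 0 + (x 1 - y 1) • unitVec (L+2) 1) 2 (x 2 - y 2)
  have e : y + (x 0 - y 0) • unitVec (L+2) 0 + (x 1 - y 1) • unitVec (L+2) 1 + (x 2 - y 2) • unitVec (L+2) 2 = x := by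
    ext j
    fin_cases j <;> simp [unitVec]
  let w := (((w0.append w1).append w2).copy rfl e).reverse
  have hl : w.length = w0.length + w1.length + w2.length := by simp [w]; omega
  refine ⟨w.length, w.getVert, w.getVert_zero, w.getVert_length, fun i hi => w.adj_getVert_succ hi, ?_⟩
  rw [hl]
  push_cast
  have g0 := coord_le (L+2) x y 0
  have g1 := coord_le (L+2) x y 1
  have g2 := coord_le (L+2) x y 2
  linarith

/-- Nearest-neighbor weights. -/
def WW (L : ℕ) (β : ℝ) : Matrix (Torus L) (Torus L) ℝ := Matrix.of fun i j => if NN i j then β else 0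

lemma WW_herm (L : ℕ) (β : ℝ) : (WW L β).IsHermitian := by
  ext i j
  have : NN j i ↔ NN i j := ⟨NN_symm, NN_symm⟩
  simp [WW, this]

lemma Dmat_eq (L : ℕ) [NeZero L] (β ε : ℝ) (t : Torus L → ℝ) : Dmat β ε t = DW (WW L β) (fun _ => ε) t := by
  ext i j
  have hs : ∀ i j : Torus L, NN j i ↔ NN i j := fun i j => ⟨NN_symm, NN_symm⟩
  simp only [Dmat, DW, WW, Matrix.of_apply, Matrix.sub_apply, Matrix.diagonal_apply]
  by_cases h : i = j
  · subst h
    have hn : ¬ NN i i := fun h => h.1 rfl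
    simp only [if_true, hn, if_false, zero_mul, sub_zero, Finset.mul_sum]
    congr 1
    refine Finset.sum_congr rfl fun k _ => ?_
    by_cases hk : NN k i
    · simp [hk, (hs i k).1 hk, add_comm]
    · have : ¬ NN i k := fun h => hk (NN_symm h)
      simp [hk, this]
  · simp only [h, if_false]
    split_ifs <;> simp

lemma integrand_eq (L : ℕ) [NeZero L] (β ε : ℝ) (t s : Torus L → ℝ) :
    (Dmat β ε t).det * Real.exp (-(β * nnSum (fun i j => Bq t s i j - 1)) - ε * ∑ k : Torus L, (zb t s k - 1)) *
      (∏ k : Torus L, Real.exp (-(t k))) = dens (WW L β) (fun _ => ε) t s := by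
  unfold dens
  rw [Dmat_eq]
  congr 3
  congr 1
  · congr 1
    unfold nnSum
    rw [mul_left_comm]
    congr 1
    simp only [Finset.mul_sum]
    refine Finset.sum_congr rfl fun i _ => Finset.sum_congr rfl fun j _ => ?_
    simp only [WW, Matrix.of_apply, Bq]
    split_ifs <;> simp
  · rw [Finset.mul_sum]; rfl

lemma dens_nonneg (L : ℕ) [NeZero L] (β ε : ℝ) (hβ : 0 < β) (hε : 0 < ε) (t s : Torus L → ℝ) :
    0 ≤ dens (WW L β) (fun _ => ε) t s := by
  have := (DW_posDef (WW L β) (fun _ => ε) (WW_herm L β) (fun i j => by simp only [WW, Matrix.of_apply]; split_ifs <;> linarith) (fun _ => hε) t).det_pos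
  unfold dens
  positivity

lemma tsExpect_le (L : ℕ) [NeZero L] (β ε : ℝ) (hβ : 0 < β) (hε : 0 < ε)
    (g : (Torus L → ℝ) → (Torus L → ℝ) → ℝ) (hg : ∀ t s, 0 ≤ g t s)
    (h : ∫⁻ p : (Torus L → ℝ) × (Torus L → ℝ), ENNReal.ofReal (dens (WW L β) (fun _ => ε) p.1 p.2 * g p.1 p.2) ≤
      2 * ENNReal.ofReal (2*Real.pi) ^ (Fintype.card (Torus L))) : tsExpect β ε g ≤ 2 := by
  unfold tsExpect
  refine (le_abs_self _).trans ?_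
  rw [← Real.norm_eq_abs]
  refine (norm_integral_le_lintegral_norm _).trans ?_
  apply ENNReal.toReal_le_of_le_ofReal (by norm_num)
  set C := ((2 * Real.pi)⁻¹) ^ (Fintype.card (Torus L)) with hC
  have hC0 : 0 < C := by positivity
  have e : ∀ p : (Torus L → ℝ) × (Torus L → ℝ), ENNReal.ofReal ‖g p.1 p.2 * (Dmat β ε p.1).det *
      Real.exp (-(β * nnSum (fun i j => Bq p.1 p.2 i j - 1))
        - ε * ∑ k : Torus L, (zb p.1 p.2 k - 1)) *
      (∏ k : Torus L, Real.exp (-(p.1 k))) * C‖ = ENNReal.ofReal (dens (WW L β) (fun _ => ε) p.1 p.2 * g p.1 p.2) * ENNReal.ofReal C := by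
    intro p
    have := dens_nonneg L β ε hβ hε p.1 p.2
    have h2 := hg p.1 p.2
    rw [← ENNReal.ofReal_mul (by positivity), ← integrand_eq, Real.norm_of_nonneg]
    · congr 1; ring
    · rw [← integrand_eq] at this
      have := mul_nonneg (mul_nonneg h2 this) hC0.le
      exact this.trans_eq (by ring)
  simp only [e]
  rw [lintegral_mul_const' _ _ ENNReal.ofReal_ne_top]
  refine (mul_le_mul_left h _).trans ?_
  rw [hC, ← ENNReal.ofReal_pow (by positivity), mul_assoc, ← ENNReal.ofReal_mul (by positivity), ← mul_pow,
    mul_inv_cancel₀ (by positivity), one_pow]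
  simp

lemma main_bound (L : ℕ) (β ε : ℝ) (hβ : 0 < β) (hε : 0 < ε) (x y : Torus (L+2)) (q : ℝ) (hq : 0 ≤ q)
    (hb : q * (3 * torusDist x y) ^ 2 ≤ β / 2) : tsExpect β ε (fun t s => Bq t s x y ^ q) ≤ 2 := by
  have hBp : ∀ (t s : Torus (L+2) → ℝ) x y, 0 < Bq t s x y := fun t s x y => by
    rw [Bq_cosh]; exact Real.cosh_pos _
  have hW := WW_herm (L+2) β
  have hW0 : ∀ i j, 0 ≤ WW (L+2) β i j := fun i j => by simp only [WW, Matrix.of_apply]; split_ifs <;> linarith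
  apply tsExpect_le _ _ _ hβ hε _ (fun t s => Real.rpow_nonneg (hBp t s x y).le _)
  obtain ⟨n, p, rfl, rfl, hp, hn⟩ := exists_path L x y
  rcases Nat.eq_zero_or_pos n with rfl | hn0
  · refine le_trans (le_trans (le_of_eq ?_) (lemD (WW (L+2) β) (fun _ => ε) hW hW0 (fun _ => hε))) ?_
    · simp [Bq]
    · exact le_mul_of_one_le_left (by simp) (by norm_num)
  have hn' : (0:ℝ) < n := by exact_mod_cast hn0
  have hqn : q * (n:ℝ)^2 ≤ β / 2 := by
    refine le_trans ?_ hb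
    gcongr
  have step : ∀ P : (Torus (L+2) → ℝ) × (Torus (L+2) → ℝ),
      ENNReal.ofReal (dens (WW (L+2) β) (fun _ => ε) P.1 P.2 * Bq P.1 P.2 (p 0) (p n) ^ q) ≤
      ∑ i ∈ Finset.range n, ENNReal.ofReal (1 / (n:ℝ)) * ENNReal.ofReal (dens (WW (L+2) β) (fun _ => ε) P.1 P.2 *
        Real.exp (β / 2 * (Bq P.1 P.2 (p i) (p (i+1)) - 1))) := by
    intro P
    have hd := dens_nonneg (L+2) β ε hβ hε P.1 P.2
    simp only [← ENNReal.ofReal_mul (show 0 ≤ 1 / (n:ℝ) by positivity)]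
    rw [← ENNReal.ofReal_sum_of_nonneg (fun i _ => by positivity)]
    apply ENNReal.ofReal_le_ofReal
    refine (mul_le_mul_of_nonneg_left (det_bound P.1 P.2 p n hn0 q (β/2) hq hqn) hd).trans (le_of_eq ?_)
    rw [Finset.mul_sum]
    exact Finset.sum_congr rfl fun i _ => by ring
  refine (lintegral_mono step).trans ?_
  rw [lintegral_finsetSum]
  · calc _ ≤ ∑ i ∈ Finset.range n, ENNReal.ofReal (1 / (n:ℝ)) * (2 * ENNReal.ofReal (2*Real.pi) ^ (Fintype.card (Torus (L+2)))) := by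
          refine Finset.sum_le_sum fun i hi => ?_
          rw [lintegral_const_mul' _ _ ENNReal.ofReal_ne_top]
          refine mul_le_mul_right ?_ _
          have hnn := hp i (Finset.mem_range.1 hi)
          have := lemE (WW (L+2) β) (fun _ => ε) hW hW0 (fun _ => hε) (p i) (p (i+1)) hnn.1
          have hw : WW (L+2) β (p i) (p (i+1)) = β := by simp [WW, hnn]
          rw [hw] at this
          exact this
      _ = 2 * ENNReal.ofReal (2*Real.pi) ^ (Fintype.card (Torus (L+2))) := by
          rw [Finset.sum_const, Finset.card_range, nsmul_eq_mul, ← mul_assoc]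
          have : (n : ENNReal) * ENNReal.ofReal (1 / (n:ℝ)) = 1 := by
            rw [← ENNReal.ofReal_natCast, ← ENNReal.ofReal_mul hn'.le, mul_one_div_cancel hn'.ne', ENNReal.ofReal_one]
          rw [this, one_mul]
      _ ≤ _ := le_rfl
  · intro i _
    have h1 := dens_cont (WW (L+2) β) (fun _ => ε)
    have h2 : Continuous fun P : (Torus (L+2) → ℝ) × (Torus (L+2) → ℝ) => dens (WW (L+2) β) (fun _ => ε) P.1 P.2 *
        Real.exp (β / 2 * (Bq P.1 P.2 (p i) (p (i+1)) - 1)) := by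
      unfold Bq
      fun_prop
    exact h2.measurable.ennreal_ofReal.const_mul _

end ShortScale

/-- **Short-scale fluctuation bound.** There is `β₀` such that for every `β ≥ β₀`,
`ε > 0`, torus side `L ≥ 8 β^{1/4}`, sites with `|x - y| ≤ β^{1/4}` and real `m ≥ 0`
with `3m ≤ β^{1/8}`, one has `⟨B_{xy}^{3m}⟩ ≤ 2`. -/
theorem short_scale_bound :
    ∃ β₀ : ℝ, ∀ β : ℝ, β₀ ≤ β → ∀ ε : ℝ, 0 < ε →
      ∀ L : ℕ, 8 * β ^ ((1 : ℝ) / 4) ≤ ((L + 2 : ℕ) : ℝ) →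
        ∀ x y : Torus (L + 2), torusDist x y ≤ β ^ ((1 : ℝ) / 4) →
          ∀ m : ℝ, 0 ≤ m → 3 * m ≤ β ^ ((1 : ℝ) / 8) →
            tsExpect β ε (fun t s => Bq t s x y ^ (3 * m)) ≤ 2 := by
  refine ⟨6561, fun β hβ ε hε L _ x y hxy m hm hm3 => ?_⟩
  have hβ0 : 0 < β := by linarith
  apply main_bound L β ε hβ0 hε x y (3 * m) (by linarith)
  set r := β ^ ((1 : ℝ) / 8) with hr
  have hr0 : 0 ≤ r := by positivity
  have hr8 : r ^ 8 = β := by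
    rw [hr, ← Real.rpow_natCast, ← Real.rpow_mul hβ0.le]; norm_num
  have hr2 : β ^ ((1 : ℝ) / 4) = r ^ 2 := by
    rw [hr, ← Real.rpow_natCast, ← Real.rpow_mul hβ0.le]; norm_num
  rw [hr2] at hxy
  have hr3 : 3 ≤ r := by
    apply le_of_pow_le_pow_left₀ (n := 8) (by norm_num) hr0
    rw [hr8]; linarith
  have hd0 : 0 ≤ torusDist x y := Real.sqrt_nonneg _
  calc 3 * m * (3 * torusDist x y) ^ 2 ≤ r * (3 * r ^ 2) ^ 2 := by gcongr
    _ = 9 * r ^ 5 := by ring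
    _ ≤ r ^ 3 / 2 * r ^ 5 := by
      apply mul_le_mul_of_nonneg_right _ (by positivity)
      have : (3:ℝ) ^ 3 ≤ r ^ 3 := pow_le_pow_left₀ (by norm_num) hr3 3
      linarith
    _ = β / 2 := by rw [← hr8]; ring

end
end

section
/- The minimizer of the effective action is the constant saddle-point configuration: let β > 0, ε > 0, L ≥ 2, and suppose t* ∈ ℝ satisfies the stationarity equation 1 − e^{2t*} = ((−βΔ + ε e^{−t*} Id)^{-1})_{xx} for every x ∈ Λ (the diagonal entry is independent of x by translation invariance of the torus), where Δ is the graph Laplacian of Λ. Then 0 ≤ 1 − e^{2t*} ≤ 1 (in particular t* ≤ 0), and for every field configuration t : Λ → ℝ one has F_{β,ε}(t) ≥ F_{β,ε}(t*·𝟙), where t*·𝟙 denotes the constant configuration equal to t* at every site. -/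
open scoped BigOperators Classical
open MeasureTheory

noncomputable section

variable {L : ℕ}

/-- The graph Laplacian of the torus: `(Δv)_j = ∑_{i ∼ j} (v_i - v_j)`. -/
def lap (L : ℕ) [NeZero L] : Matrix (Torus L) (Torus L) ℝ :=
  Matrix.of fun j k =>
    if j = k then -(∑ i : Torus L, if NN i j then (1 : ℝ) else 0)
    else if NN j k then 1 else 0

open scoped Matrix MatrixOrder in
lemma logdet_le {n : Type*} [Fintype n] [DecidableEq n] {A B : Matrix n n ℝ}
    (hA : A.PosDef) (hB : B.PosDef) :
    Real.log B.det ≤ Real.log A.det + ((A⁻¹ * B).trace - Fintype.card n) := by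
  have hAi : (A⁻¹).PosDef := hA.inv
  obtain ⟨S, hS⟩ : ∃ S : Matrix n n ℝ, A⁻¹ = Sᴴ * S := by
    exact CStarAlgebra.nonneg_iff_eq_star_mul_self.mp hAi.posSemidef.nonneg
  have hC : (S * B * Sᴴ).PosSemidef := hB.posSemidef.mul_mul_conjTranspose_same S
  have hdet : (S * B * Sᴴ).det = B.det / A.det := by
    have h1 : (A⁻¹).det = Sᴴ.det * S.det := by rw [hS, Matrix.det_mul]
    rw [Matrix.det_nonsing_inv, Ring.inverse_eq_inv'] at h1
    rw [Matrix.det_mul, Matrix.det_mul, div_eq_mul_inv, h1]; ring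
  have htr : (S * B * Sᴴ).trace = (A⁻¹ * B).trace := by
    rw [Matrix.trace_mul_comm, ← Matrix.mul_assoc, ← hS]
  have hdA := hA.det_pos
  have hdB := hB.det_pos
  have hdC : 0 < (S * B * Sᴴ).det := by rw [hdet]; positivity
  have hlog : Real.log (S * B * Sᴴ).det = Real.log B.det - Real.log A.det := by
    rw [hdet, Real.log_div hdB.ne' hdA.ne']
  have hd := hC.1.det_eq_prod_eigenvalues
  have ht := hC.1.trace_eq_sum_eigenvalues
  simp only [RCLike.ofReal_real_eq_id, id_eq] at hd ht
  have hne : ∀ i ∈ Finset.univ, hC.1.eigenvalues i ≠ 0 := by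
    apply Finset.prod_ne_zero_iff.mp
    rw [← hd]; exact hdC.ne'
  have hle : Real.log (S * B * Sᴴ).det ≤ (S * B * Sᴴ).trace - Fintype.card n := by
    rw [hd, ht, Real.log_prod hne]
    have : ∑ i, hC.1.eigenvalues i - (Fintype.card n : ℝ) = ∑ i, (hC.1.eigenvalues i - 1) := by
      simp [Finset.sum_sub_distrib]
    rw [this]
    refine Finset.sum_le_sum fun i hi => ?_
    exact Real.log_le_sub_one_of_pos
      (lt_of_le_of_ne (hC.eigenvalues_nonneg i) (hne i hi).symm)
  rw [hlog, htr] at hle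
  linarith

lemma posDef_of_weights {n : Type*} [Fintype n] [DecidableEq n] (w : n → n → ℝ) (c : n → ℝ)
    (hs : ∀ i j, w i j = w j i) (hw : ∀ i j, 0 ≤ w i j) (hc : ∀ i, 0 < c i) :
    (Matrix.diagonal (fun j => ∑ i, w i j + c j) - Matrix.of w).PosDef := by
  refine Matrix.PosDef.of_dotProduct_mulVec_pos ?_ ?_
  · ext i j
    simp only [Matrix.conjTranspose_apply, Matrix.sub_apply, Matrix.of_apply, star_trivial, hs j i]
    rw [Matrix.diagonal_apply, Matrix.diagonal_apply]
    by_cases h : i = j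
    · subst h; rfl
    · simp [h, Ne.symm h]
  · intro x hx
    have key : star x ⬝ᵥ ((Matrix.diagonal (fun j => ∑ i, w i j + c j) - Matrix.of w).mulVec x)
        = (1/2) * (∑ j, ∑ i, w i j * (x i - x j)^2) + ∑ j, c j * x j ^ 2 := by
      have e1 : ∑ j, ∑ i, w i j * (x i - x j)^2
          = ∑ j, ∑ i, w i j * x i ^ 2 + ∑ j, ∑ i, w i j * x j ^ 2
            - 2 * ∑ j, ∑ i, x j * (w j i * x i) := by
        simp only [Finset.mul_sum, ← Finset.sum_add_distrib, ← Finset.sum_sub_distrib]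
        refine Finset.sum_congr rfl fun j _ => Finset.sum_congr rfl fun i _ => ?_
        rw [hs j i]; ring
      have e2 : ∑ j, ∑ i, w i j * x i ^ 2 = ∑ j, ∑ i, w i j * x j ^ 2 := by
        rw [Finset.sum_comm]
        refine Finset.sum_congr rfl fun j _ => Finset.sum_congr rfl fun i _ => ?_
        rw [hs j i]
      rw [e1, e2, Matrix.sub_mulVec, dotProduct_sub]
      simp only [dotProduct, Matrix.mulVec_diagonal, Matrix.mulVec, Matrix.of_apply, star_trivial,
        Finset.mul_sum]
      have e3 : ∑ j, x j * ((∑ i, w i j + c j) * x j)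
          = ∑ j, ∑ i, w i j * x j ^ 2 + ∑ j, c j * x j ^ 2 := by
        rw [← Finset.sum_add_distrib]
        refine Finset.sum_congr rfl fun j _ => ?_
        rw [← Finset.sum_mul]; ring
      simp only [Matrix.diagonal_apply, ite_mul, zero_mul, Finset.sum_ite_eq, Finset.mem_univ, if_true, mul_ite, mul_zero] at *
      rw [e3]
      simp only [← Finset.mul_sum]
      ring
    rw [key]
    have h1 : 0 ≤ ∑ j, ∑ i, w i j * (x i - x j)^2 :=
      Finset.sum_nonneg fun j _ => Finset.sum_nonneg fun i _ => mul_nonneg (hw _ _) (sq_nonneg _)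
    have h2 : 0 < ∑ j, c j * x j ^ 2 := by
      obtain ⟨k, hk⟩ := Function.ne_iff.mp hx
      refine Finset.sum_pos' (fun i _ => mul_nonneg (hc i).le (sq_nonneg _)) ⟨k, Finset.mem_univ _, ?_⟩
      have : x k ≠ 0 := hk
      have := hc k
      positivity
    linarith

lemma NN.symm' {x y : Torus L} (h : NN x y) : NN y x := by
  obtain ⟨h1, i, h2⟩ := h
  refine ⟨h1.symm, i, ?_⟩
  rcases h2 with h2 | h2
  · right; rw [h2]; abel
  · left; rw [h2]; abel

lemma NN_comm' {x y : Torus L} : NN x y ↔ NN y x := ⟨NN.symm', NN.symm'⟩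

lemma not_NN_self (x : Torus L) : ¬ NN x x := fun h => h.1 rfl

lemma Dmat_posDef [NeZero L] (β ε : ℝ) (hβ : 0 < β) (hε : 0 < ε) (t : Torus L → ℝ) :
    (Dmat β ε t).PosDef := by
  have := posDef_of_weights (n := Torus L)
    (fun i j => if NN i j then β * Real.exp (t i + t j) else 0) (fun j => ε * Real.exp (t j))
    (fun i j => by simp only [NN_comm' (x := i), add_comm (t i)])
    (fun i j => by split_ifs <;> positivity) (fun i => by positivity)
  convert this using 1
  ext j k
  simp only [Dmat, Matrix.of_apply, Matrix.sub_apply, Matrix.diagonal_apply]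
  by_cases h : j = k
  · subst h
    simp [not_NN_self, Finset.mul_sum]
  · simp only [h, if_false]
    split_ifs <;> simp

/-- The conjugated matrix. -/
def Hmat [NeZero L] (β ε : ℝ) (t : Torus L → ℝ) : Matrix (Torus L) (Torus L) ℝ :=
  Matrix.diagonal (fun j => Real.exp (-t j)) * Dmat β ε t *
    Matrix.diagonal (fun j => Real.exp (-t j))

lemma Hmat_posDef [NeZero L] (β ε : ℝ) (hβ : 0 < β) (hε : 0 < ε) (t : Torus L → ℝ) :
    (Hmat β ε t).PosDef := by
  refine Matrix.PosDef.of_dotProduct_mulVec_pos ?_ ?_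
  · have := Matrix.isHermitian_mul_mul_conjTranspose
      (Matrix.diagonal (fun j => Real.exp (-t j))) (Dmat_posDef β ε hβ hε t).1
    simpa [Hmat, Matrix.diagonal_conjTranspose] using this
  · intro x hx
    have h := (Dmat_posDef β ε hβ hε t).dotProduct_mulVec_pos
      (x := (Matrix.diagonal (fun j => Real.exp (-t j))).mulVec x) (by
        obtain ⟨k, hk⟩ := Function.ne_iff.mp hx
        refine Function.ne_iff.mpr ⟨k, ?_⟩
        have : x k ≠ 0 := hk
        simp [Matrix.mulVec_diagonal, this])
    have e : star x ⬝ᵥ (Hmat β ε t).mulVec x =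
        star ((Matrix.diagonal (fun j => Real.exp (-t j))).mulVec x) ⬝ᵥ
          (Dmat β ε t).mulVec ((Matrix.diagonal (fun j => Real.exp (-t j))).mulVec x) := by
      rw [Hmat, ← Matrix.mulVec_mulVec, ← Matrix.mulVec_mulVec, Matrix.dotProduct_mulVec,
        star_trivial, star_trivial]
      congr 1
      ext k
      simp [Matrix.mulVec_diagonal, Matrix.vecMul_diagonal, mul_comm]
    rw [e]; exact h

lemma log_det_Dmat [NeZero L] (β ε : ℝ) (hβ : 0 < β) (hε : 0 < ε) (t : Torus L → ℝ) :
    Real.log (Dmat β ε t).det = 2 * ∑ k, t k + Real.log (Hmat β ε t).det := by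
  have hD := (Dmat_posDef β ε hβ hε t).det_pos
  have e : (Hmat β ε t).det = Real.exp (-∑ k, t k) * (Dmat β ε t).det * Real.exp (-∑ k, t k) := by
    rw [Hmat, Matrix.det_mul, Matrix.det_mul, Matrix.det_diagonal, ← Real.exp_sum,
      Finset.sum_neg_distrib]
  rw [e, Real.log_mul (by positivity) (by positivity), Real.log_mul (by positivity) hD.ne',
    Real.log_exp]
  ring

lemma Hmat_eq [NeZero L] (β ε s : ℝ) (t : Torus L → ℝ) :
    Hmat β ε t = ((-β) • lap L + (ε * Real.exp (-s)) • (1 : Matrix (Torus L) (Torus L) ℝ)) +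
      Matrix.diagonal (fun j => β * (∑ i, if NN i j then (Real.exp (t i - t j) - 1) else 0)
        + ε * Real.exp (-t j) - ε * Real.exp (-s)) := by
  ext j k
  simp only [Hmat, Matrix.mul_diagonal, Matrix.diagonal_mul, Dmat, lap, Matrix.of_apply,
    Matrix.add_apply, Matrix.smul_apply, Matrix.diagonal_apply, Matrix.one_apply, smul_eq_mul]
  by_cases h : j = k
  · subst h
    simp only [if_true]
    have e1 : (∑ i, if NN i j then Real.exp (t i + t j) else 0) =
        Real.exp (2 * t j) * ∑ i, if NN i j then Real.exp (t i - t j) else 0 := by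
      rw [Finset.mul_sum]
      refine Finset.sum_congr rfl fun i _ => ?_
      split_ifs
      · rw [← Real.exp_add]; ring_nf
      · simp
    have e2 : (∑ i, if NN i j then (Real.exp (t i - t j) - 1) else 0) =
        (∑ i, if NN i j then Real.exp (t i - t j) else 0) - ∑ i, if NN i j then (1:ℝ) else 0 := by
      rw [← Finset.sum_sub_distrib]
      refine Finset.sum_congr rfl fun i _ => ?_
      split_ifs <;> simp
    rw [e1, e2]
    have h1 : Real.exp (2 * t j) = Real.exp (t j) ^ 2 := by rw [← Real.exp_nat_mul]; norm_num
    rw [h1, Real.exp_neg (t j)]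
    have := Real.exp_pos (t j)
    field_simp
    ring
  · simp only [h, if_false]
    split_ifs
    · rw [Real.exp_add, Real.exp_neg, Real.exp_neg]
      have := Real.exp_pos (t j)
      have := Real.exp_pos (t k)
      field_simp
      ring
    · simp

lemma sum_NN_eq [NeZero L] (t : Torus L → ℝ) :
    ∑ j, ∑ i, (if NN i j then (Real.exp (t i - t j) - 1) else 0) =
      2 * nnSum (fun i j => Real.cosh (t i - t j) - 1) := by
  have e : ∑ j, ∑ i, (if NN i j then (Real.exp (t i - t j) - 1) else 0) =
      ∑ j, ∑ i, (if NN i j then (Real.exp (t j - t i) - 1) else 0) := by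
    rw [Finset.sum_comm]
    refine Finset.sum_congr rfl fun j _ => Finset.sum_congr rfl fun i _ => ?_
    simp only [NN_comm' (x := j)]
  have e' : 2 * nnSum (fun i j => Real.cosh (t i - t j) - 1) =
      (1/2) * (∑ j, ∑ i, (if NN i j then (Real.exp (t i - t j) - 1) else 0)
        + ∑ j, ∑ i, (if NN i j then (Real.exp (t j - t i) - 1) else 0)) := by
    rw [nnSum, Finset.sum_comm]
    simp only [Finset.mul_sum, ← Finset.sum_add_distrib]
    refine Finset.sum_congr rfl fun j _ => Finset.sum_congr rfl fun i _ => ?_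
    split_ifs
    · rw [Real.cosh_eq, neg_sub]; ring
    · simp
  rw [e', ← e]; ring

lemma nnSum_nonneg' [NeZero L] (t : Torus L → ℝ) :
    0 ≤ nnSum (fun i j => Real.cosh (t i - t j) - 1) := by
  unfold nnSum
  refine mul_nonneg (by norm_num) (Finset.sum_nonneg fun i _ => Finset.sum_nonneg fun j _ => ?_)
  split_ifs
  · linarith [Real.one_le_cosh (t i - t j)]
  · exact le_rfl

/-- **The minimizer of the effective action is the constant saddle configuration.**
If `t* ∈ ℝ` satisfies the stationarity equation
`1 - e^{2t*} = ((-βΔ + ε e^{-t*} Id)⁻¹)_{xx}` for every site `x`, then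
`0 ≤ 1 - e^{2t*} ≤ 1` (in particular `t* ≤ 0`), and the constant configuration `t* 𝟙`
minimizes the free energy `F_{β,ε}`. -/
theorem saddle_point_minimizes (β ε : ℝ) (hβ : 0 < β) (hε : 0 < ε) (L : ℕ) (tstar : ℝ)
    (hstat : ∀ x : Torus (L + 2),
      1 - Real.exp (2 * tstar) =
        ((-β) • lap (L + 2) +
            (ε * Real.exp (-tstar)) • (1 : Matrix (Torus (L + 2)) (Torus (L + 2)) ℝ))⁻¹ x x) :
    (0 ≤ 1 - Real.exp (2 * tstar)) ∧ (1 - Real.exp (2 * tstar) ≤ 1) ∧ tstar ≤ 0 ∧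
      ∀ t : Torus (L + 2) → ℝ,
        freeEnergy (L := L + 2) β ε (fun _ => tstar) ≤ freeEnergy β ε t := by
  have hHc : Hmat β ε (fun _ : Torus (L+2) => tstar) = ((-β) • lap (L + 2) +
      (ε * Real.exp (-tstar)) • (1 : Matrix (Torus (L + 2)) (Torus (L + 2)) ℝ)) := by
    rw [Hmat_eq β ε tstar]; simp
  have hA := Hmat_posDef β ε hβ hε (fun _ : Torus (L+2) => tstar)
  have hg : 0 < 1 - Real.exp (2 * tstar) := by
    rw [hstat 0, ← hHc]
    exact hA.inv.diag_pos
  have hexp := Real.exp_pos (2 * tstar)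
  refine ⟨hg.le, by linarith, ?_, fun t => ?_⟩
  · have : Real.exp (2 * tstar) ≤ 1 := by linarith
    have := Real.exp_le_one_iff.mp this
    linarith
  have hB := Hmat_posDef β ε hβ hε t
  have hld := logdet_le hA hB
  rw [← hHc] at hstat
  have htr : ((Hmat β ε (fun _ : Torus (L+2) => tstar))⁻¹ * Hmat β ε t).trace
      = Fintype.card (Torus (L+2)) + (1 - Real.exp (2 * tstar)) *
        (2 * β * nnSum (fun i j => Real.cosh (t i - t j) - 1) +
          ∑ j, (ε * Real.exp (-t j) - ε * Real.exp (-tstar))) := by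
    rw [Hmat_eq β ε tstar t, ← hHc, mul_add, Matrix.trace_add,
      Matrix.nonsing_inv_mul _ (isUnit_iff_ne_zero.mpr hA.det_pos.ne'), Matrix.trace_one]
    congr 1
    rw [mul_comm 2 β, mul_assoc, ← sum_NN_eq, Finset.mul_sum, ← Finset.sum_add_distrib,
      Finset.mul_sum]
    simp only [Matrix.trace, Matrix.diag_apply, Matrix.mul_diagonal]
    refine Finset.sum_congr rfl fun j _ => ?_
    rw [← hstat j]; ring
  rw [htr] at hld
  unfold freeEnergy
  rw [log_det_Dmat β ε hβ hε, log_det_Dmat β ε hβ hε]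
  have h0 : nnSum (fun _ _ : Torus (L+2) => Real.cosh (tstar - tstar) - 1) = 0 := by
    simp [nnSum]
  rw [h0]
  have hS := mul_nonneg hβ.le (nnSum_nonneg' t)
  set S := nnSum (fun i j => Real.cosh (t i - t j) - 1) with hSdef
  have hSe : 0 ≤ Real.exp (2 * tstar) * (β * S) := mul_nonneg hexp.le hS
  have hpt : 0 ≤ ∑ j, (ε * Real.cosh (t j) - ε * Real.cosh tstar -
      (1/2) * (1 - Real.exp (2 * tstar)) * (ε * Real.exp (-t j) - ε * Real.exp (-tstar))) := by
    refine Finset.sum_nonneg fun j _ => ?_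
    have e2 : Real.exp (2 * tstar) = Real.exp tstar ^ 2 := by
      rw [← Real.exp_nat_mul]; norm_num
    rw [e2, Real.cosh_eq, Real.cosh_eq, Real.exp_neg, Real.exp_neg]
    have ha := Real.exp_pos tstar
    have hb := Real.exp_pos (t j)
    have : ε * ((Real.exp (t j) + (Real.exp (t j))⁻¹) / 2) -
        ε * ((Real.exp tstar + (Real.exp tstar)⁻¹) / 2) -
        (1/2) * (1 - Real.exp tstar ^ 2) * (ε * (Real.exp (t j))⁻¹ - ε * (Real.exp tstar)⁻¹)
        = ε / 2 * (Real.exp (t j) - Real.exp tstar)^2 / Real.exp (t j) := by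
      field_simp
      ring
    rw [this]
    positivity
  simp only [Finset.sum_add_distrib, Finset.sum_sub_distrib, ← Finset.mul_sum] at hpt hld ⊢
  nlinarith [hpt, hld, hSe]

end
end
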